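/- arXiv:2509.20213 — 2 statements merged into one kernel-verified Lean document; each statement's English description precedes it below -/
import Mathlib

section
/- For any N×N complex matrices A and B and any partition λ with at most N parts, ∫_{SU(N)} s_λ(UA) s_λ(U† B) dμ(U) = s_λ(AB) / s_λ(I_N). -/
open scoped BigOperators Classical
open MeasureTheory Matrix

noncomputable section

/-- Complete homogeneous symmetric functions of the eigenvalues of `X`, defined through
Newton's identities from the power sums `p_m = Tr(X^m)`. -/
def hMat {N : ℕ} (X : Matrix (Fin N) (Fin N) ℂ) : ℕ → ℂ
  | 0 => 1
  | (k+1) => ((k : ℂ) + 1)⁻¹ *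
      ∑ m ∈ Finset.range (k+1), (X ^ (m+1)).trace * hMat X (k - m)
  termination_by k => k
  decreasing_by exact Nat.lt_succ_of_le (Nat.sub_le _ _)

def hMatZ {N : ℕ} (X : Matrix (Fin N) (Fin N) ℂ) (k : ℤ) : ℂ :=
  if k < 0 then 0 else hMat X k.toNat

/-- The Schur polynomial `s_λ(X)` of an `N×N` complex matrix `X`, evaluated at the
eigenvalues of `X`, via the Jacobi-Trudi formula `s_λ = det(h_{λ_i - i + j})`.
Here `l : Fin N → ℕ` lists the (at most `N`) parts of the partition `λ`. -/
def schur {N : ℕ} (l : Fin N → ℕ) (X : Matrix (Fin N) (Fin N) ℂ) : ℂ :=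
  (Matrix.of fun i j : Fin N => hMatZ X ((l i : ℤ) - (i : ℤ) + (j : ℤ))).det

/-- Partitions with at most `N` parts (weakly decreasing functions `Fin N → ℕ`). -/
def PartitionN (N : ℕ) := {l : Fin N → ℕ // Antitone l}

/-- The unitary group `U(N)`. -/
abbrev UN (N : ℕ) := Matrix.unitaryGroup (Fin N) ℂ

instance (N : ℕ) : MeasurableSpace (UN N) := borel _

/-- The special unitary group `SU(N)`, as a subgroup of `U(N)`. -/
def SUN (N : ℕ) : Subgroup (UN N) where
  carrier := {U | (U : Matrix (Fin N) (Fin N) ℂ).det = 1}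
  one_mem' := by simp
  mul_mem' := by
    intro a b ha hb
    simp only [Set.mem_setOf_eq, Submonoid.coe_mul, Matrix.det_mul] at *
    rw [ha, hb, mul_one]
  inv_mem' := by
    intro a ha
    simp only [Set.mem_setOf_eq] at *
    have h1 : ((a⁻¹ : UN N) : Matrix (Fin N) (Fin N) ℂ)
        = star (a : Matrix (Fin N) (Fin N) ℂ) := rfl
    have h2 : (star (a : Matrix (Fin N) (Fin N) ℂ)).det
        = star ((a : Matrix (Fin N) (Fin N) ℂ)).det := by
      simp [Matrix.star_eq_conjTranspose, Matrix.det_conjTranspose]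
    rw [h1, h2, ha, star_one]

instance (N : ℕ) : MeasurableSpace (SUN N) := borel _

/-- The algebra of polynomial functions in the entries of a square matrix. -/
def polyFun (N : ℕ) : Subalgebra ℂ (Matrix (Fin N) (Fin N) ℂ → ℂ) :=
  Algebra.adjoin ℂ (Set.range fun (p : Fin N × Fin N) X => X p.1 p.2)

section PolyFun

variable {N : ℕ} {F : Matrix (Fin N) (Fin N) ℂ → ℂ}

theorem entry_mem_polyFun (i j : Fin N) :
    (fun X : Matrix (Fin N) (Fin N) ℂ => X i j) ∈ polyFun N :=
  Algebra.subset_adjoin ⟨(i, j), rfl⟩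

theorem const_mem_polyFun (c : ℂ) : (fun _ : Matrix (Fin N) (Fin N) ℂ => c) ∈ polyFun N :=
  (polyFun N).algebraMap_mem c

theorem sum_mem_polyFun {ι : Type*} (s : Finset ι) {f : ι → Matrix (Fin N) (Fin N) ℂ → ℂ}
    (h : ∀ i ∈ s, f i ∈ polyFun N) : (fun X => ∑ i ∈ s, f i X) ∈ polyFun N := by
  have := (polyFun N).sum_mem h
  convert this using 1
  ext X; simp

theorem prod_mem_polyFun {ι : Type*} (s : Finset ι) {f : ι → Matrix (Fin N) (Fin N) ℂ → ℂ}
    (h : ∀ i ∈ s, f i ∈ polyFun N) : (fun X => ∏ i ∈ s, f i X) ∈ polyFun N := by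
  have := (polyFun N).prod_mem h
  convert this using 1
  ext X; simp

theorem det_mem_polyFun {m : Type*} [Fintype m] [DecidableEq m]
    {M : Matrix (Fin N) (Fin N) ℂ → Matrix m m ℂ} (h : ∀ i j, (fun X => M X i j) ∈ polyFun N) :
    (fun X => (M X).det) ∈ polyFun N := by
  simp only [det_apply']
  exact sum_mem_polyFun _ fun σ _ => (polyFun N).mul_mem (const_mem_polyFun _)
    (prod_mem_polyFun _ fun i _ => h _ _)

/-- Substituting polynomial expressions for the entries gives a polynomial. -/
theorem exists_eval_of_mem_polyFun (hF : F ∈ polyFun N) {τ : Type*}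
    {M : (τ → ℂ) → Matrix (Fin N) (Fin N) ℂ}
    (hM : ∀ i j, ∃ p : MvPolynomial τ ℂ, ∀ x, M x i j = MvPolynomial.eval x p) :
    ∃ p : MvPolynomial τ ℂ, ∀ x, F (M x) = MvPolynomial.eval x p := by
  induction hF using Algebra.adjoin_induction with
  | mem f hf => obtain ⟨⟨i, j⟩, rfl⟩ := hf; exact hM i j
  | algebraMap r => exact ⟨MvPolynomial.C r, fun x => by simp⟩
  | add f g _ _ hf hg =>
    obtain ⟨p, hp⟩ := hf
    obtain ⟨q, hq⟩ := hg
    exact ⟨p + q, fun x => by simp [hp, hq]⟩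
  | mul f g _ _ hf hg =>
    obtain ⟨p, hp⟩ := hf
    obtain ⟨q, hq⟩ := hg
    exact ⟨p * q, fun x => by simp [hp, hq]⟩

theorem eq_zero_of_forall_mem_infinite (hF : F ∈ polyFun N) {τ : Type*}
    {M : (τ → ℂ) → Matrix (Fin N) (Fin N) ℂ}
    (hM : ∀ i j, ∃ p : MvPolynomial τ ℂ, ∀ x, M x i j = MvPolynomial.eval x p)
    {S : Set ℂ} (hS : S.Infinite) (h0 : ∀ x, (∀ t, x t ∈ S) → F (M x) = 0) (x : τ → ℂ) :
    F (M x) = 0 := by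
  obtain ⟨p, hp⟩ := exists_eval_of_mem_polyFun hF hM
  have : p = 0 := MvPolynomial.funext_set (fun _ => S) (fun _ => hS) fun x hx => by
    rw [← hp, h0 x fun t => hx t trivial, map_zero]
  rw [hp, this, map_zero]

theorem exists_eval_entries (hF : F ∈ polyFun N) : ∃ p : MvPolynomial (Fin N × Fin N) ℂ,
    ∀ X, F X = MvPolynomial.eval (fun ij => X ij.1 ij.2) p := by
  obtain ⟨p, hp⟩ := exists_eval_of_mem_polyFun hF (τ := Fin N × Fin N)
    (M := fun x => Matrix.of fun i j => x (i, j)) (fun i j => ⟨MvPolynomial.X (i, j), by simp⟩)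
  exact ⟨p, fun X => by rw [← hp]; rfl⟩

theorem comp_mem_polyFun (hF : F ∈ polyFun N)
    {M : Matrix (Fin N) (Fin N) ℂ → Matrix (Fin N) (Fin N) ℂ}
    (hM : ∀ i j, (fun X => M X i j) ∈ polyFun N) : (fun X => F (M X)) ∈ polyFun N := by
  induction hF using Algebra.adjoin_induction with
  | mem f hf => obtain ⟨⟨i, j⟩, rfl⟩ := hf; exact hM i j
  | algebraMap r => exact const_mem_polyFun r
  | add f g _ _ hf hg => exact (polyFun N).add_mem hf hg
  | mul f g _ _ hf hg => exact (polyFun N).mul_mem hf hg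

theorem comp_mul_mem_polyFun (hF : F ∈ polyFun N) (A B : Matrix (Fin N) (Fin N) ℂ) :
    (fun X => F (A * X * B)) ∈ polyFun N := by
  refine comp_mem_polyFun hF fun i j => ?_
  simp only [Matrix.mul_apply]
  exact sum_mem_polyFun _ fun k _ => (polyFun N).mul_mem
    (sum_mem_polyFun _ fun l _ => (polyFun N).mul_mem (const_mem_polyFun _)
      (entry_mem_polyFun _ _)) (const_mem_polyFun _)

theorem comp_mul_left_mem_polyFun (hF : F ∈ polyFun N) (A : Matrix (Fin N) (Fin N) ℂ) :
    (fun X => F (A * X)) ∈ polyFun N := by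
  simpa using comp_mul_mem_polyFun hF A 1

theorem comp_mul_right_mem_polyFun (hF : F ∈ polyFun N) (A : Matrix (Fin N) (Fin N) ℂ) :
    (fun X => F (X * A)) ∈ polyFun N := by
  simpa using comp_mul_mem_polyFun hF 1 A

/-- A polynomial function of a product of matrices is a finite sum of products of polynomial
functions of the factors. -/
theorem exists_comul (hF : F ∈ polyFun N) :
    ∃ (ι : Type) (_ : Fintype ι) (a b : ι → Matrix (Fin N) (Fin N) ℂ → ℂ),
      (∀ i, a i ∈ polyFun N) ∧ (∀ i, b i ∈ polyFun N) ∧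
        ∀ X Y, F (X * Y) = ∑ i, a i X * b i Y := by
  induction hF using Algebra.adjoin_induction with
  | mem f hf =>
    obtain ⟨⟨i, j⟩, rfl⟩ := hf
    exact ⟨Fin N, inferInstance, fun k X => X i k, fun k Y => Y k j,
      fun k => entry_mem_polyFun _ _, fun k => entry_mem_polyFun _ _,
      fun X Y => by simp [Matrix.mul_apply]⟩
  | algebraMap r =>
    exact ⟨Unit, inferInstance, fun _ _ => r, fun _ _ => 1, fun _ => const_mem_polyFun _,
      fun _ => const_mem_polyFun _, fun X Y => by simp⟩
  | add f g _ _ hf hg =>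
    obtain ⟨ι, _, a, b, ha, hb, h⟩ := hf
    obtain ⟨κ, _, c, d, hc, hd, h'⟩ := hg
    exact ⟨ι ⊕ κ, inferInstance, Sum.elim a c, Sum.elim b d, by simp [ha, hc], by simp [hb, hd],
      fun X Y => by simp [h, h']⟩
  | mul f g _ _ hf hg =>
    obtain ⟨ι, _, a, b, ha, hb, h⟩ := hf
    obtain ⟨κ, _, c, d, hc, hd, h'⟩ := hg
    refine ⟨ι × κ, inferInstance, fun p => a p.1 * c p.2, fun p => b p.1 * d p.2,
      fun p => (polyFun N).mul_mem (ha _) (hc _), fun p => (polyFun N).mul_mem (hb _) (hd _),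
      fun X Y => ?_⟩
    simp only [Pi.mul_apply, h, h', Finset.sum_mul_sum, Fintype.sum_prod_type]
    exact Finset.sum_congr rfl fun i _ => Finset.sum_congr rfl fun j _ => by ring

theorem continuous_of_mem_polyFun (hF : F ∈ polyFun N) : Continuous F := by
  induction hF using Algebra.adjoin_induction with
  | mem f hf => obtain ⟨⟨i, j⟩, rfl⟩ := hf; exact continuous_id.matrix_elem i j
  | algebraMap r => exact continuous_const
  | add f g _ _ hf hg => exact hf.add hg
  | mul f g _ _ hf hg => exact hf.mul hg

end PolyFun

section Density

open scoped ComplexOrder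

variable {N : ℕ} {F : Matrix (Fin N) (Fin N) ℂ → ℂ}

/-- Entries of `V * diagonal x * W` are polynomials in `x`. -/
theorem mul_diagonal_mul_apply_eq_eval (V W : Matrix (Fin N) (Fin N) ℂ) (i j : Fin N) :
    ∃ p : MvPolynomial (Fin N) ℂ, ∀ x, (V * diagonal x * W) i j = MvPolynomial.eval x p :=
  ⟨∑ k, MvPolynomial.C (V i k * W k j) * MvPolynomial.X k, fun x => by
    rw [Matrix.mul_apply]
    simp only [mul_diagonal, map_sum, map_mul, MvPolynomial.eval_C,
      MvPolynomial.eval_X]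
    exact Finset.sum_congr rfl fun k _ => by ring⟩

theorem mul_diagonal_mul_eq_zero (hF : F ∈ polyFun N) (V W : Matrix (Fin N) (Fin N) ℂ)
    {S : Set ℂ} (hS : S.Infinite) (h0 : ∀ x, (∀ t, x t ∈ S) → F (V * diagonal x * W) = 0)
    (x : Fin N → ℂ) : F (V * diagonal x * W) = 0 :=
  eq_zero_of_forall_mem_infinite hF (mul_diagonal_mul_apply_eq_eval V W) hS h0 x

theorem infinite_ofReal_pos : ((fun r : ℝ => (r : ℂ)) '' Set.Ioi 0).Infinite :=
  (Set.Ioi_infinite 0).image Complex.ofReal_injective.injOn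

theorem infinite_unit_complex : {z : ℂ | star z * z = 1}.Infinite := by
  have : Set.Infinite ((fun z : Circle => (z : ℂ)) '' Set.univ) := by
    refine Set.Infinite.image Subtype.val_injective.injOn (Set.infinite_univ_iff.mpr ?_)
    have : Infinite (Set.Ioc (-Real.pi) Real.pi) :=
      Set.infinite_coe_iff.mpr (Set.Ioc_infinite (by linarith [Real.pi_pos]))
    exact Infinite.of_injective _ Circle.argEquiv.symm.injective
  refine this.mono ?_
  rintro _ ⟨z, -, rfl⟩
  change star (z : ℂ) * z = 1
  rw [mul_comm]
  refine (Complex.mul_conj (z : ℂ)).trans ?_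
  rw [Circle.normSq_coe, Complex.ofReal_one]

/-- Singular value decomposition of an invertible matrix. -/
theorem exists_unitary_mul_diagonal_mul_unitary {A : Matrix (Fin N) (Fin N) ℂ}
    (hA : IsUnit A.det) : ∃ V ∈ unitaryGroup (Fin N) ℂ, ∃ W ∈ unitaryGroup (Fin N) ℂ,
      ∃ x : Fin N → ℂ, A = V * diagonal x * W := by
  have hP : (Aᴴ * A).PosDef :=
    PosDef.conjTranspose_mul_self A (mulVec_injective_of_isUnit ((isUnit_iff_isUnit_det A).mpr hA))
  set W : Matrix (Fin N) (Fin N) ℂ := hP.1.eigenvectorUnitary.1 with hW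
  set e := hP.1.eigenvalues with he
  have hpos : ∀ i, 0 < e i := hP.eigenvalues_pos
  have hWU : W ∈ unitaryGroup (Fin N) ℂ := hP.1.eigenvectorUnitary.2
  have hW1 : Wᴴ * W = 1 := mem_unitaryGroup_iff'.mp hWU
  have hW2 : W * Wᴴ = 1 := mem_unitaryGroup_iff.mp hWU
  have hsp : Wᴴ * (Aᴴ * A) * W = diagonal fun i => (e i : ℂ) := by
    have h : Aᴴ * A = W * diagonal (fun i => (e i : ℂ)) * Wᴴ := by
      conv_lhs => rw [hP.1.spectral_theorem, Unitary.conjStarAlgAut_apply]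
      rfl
    rw [h]
    calc _ = (Wᴴ * W) * diagonal (fun i => (e i : ℂ)) * (Wᴴ * W) := by
          simp only [Matrix.mul_assoc]
      _ = _ := by rw [hW1, Matrix.one_mul, Matrix.mul_one]
  set x : Fin N → ℂ := fun i => (Real.sqrt (e i) : ℂ) with hx
  set y : Fin N → ℂ := fun i => ((Real.sqrt (e i))⁻¹ : ℝ) with hy
  have hyx : diagonal y * diagonal x = (1 : Matrix (Fin N) (Fin N) ℂ) := by
    rw [diagonal_mul_diagonal, ← diagonal_one]
    congr 1
    ext i
    have := (Real.sqrt_pos.mpr (hpos i)).ne'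
    rw [hx, hy]
    simp only [← Complex.ofReal_mul, inv_mul_cancel₀ this, Complex.ofReal_one]
  have hyH : (diagonal y)ᴴ = diagonal y := by
    rw [diagonal_conjTranspose]
    congr 1
    ext i
    simp [hy]
  refine ⟨A * W * diagonal y, ?_, Wᴴ, Unitary.star_mem hWU, x, ?_⟩
  · rw [mem_unitaryGroup_iff', star_eq_conjTranspose, conjTranspose_mul, conjTranspose_mul, hyH]
    calc _ = diagonal y * (Wᴴ * (Aᴴ * A) * W) * diagonal y := by simp only [Matrix.mul_assoc]
      _ = 1 := by
        rw [hsp, diagonal_mul_diagonal, diagonal_mul_diagonal, ← diagonal_one]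
        congr 1
        ext i
        have := (Real.sqrt_pos.mpr (hpos i)).ne'
        simp only [hy]
        rw [← Complex.ofReal_mul, ← Complex.ofReal_mul, ← Complex.ofReal_one]
        congr 1
        field_simp
        rw [Real.sq_sqrt (hpos i).le]
  · calc A = A * (W * Wᴴ) := by rw [hW2, Matrix.mul_one]
      _ = A * W * (diagonal y * diagonal x) * Wᴴ := by
        rw [hyx, Matrix.mul_one, Matrix.mul_assoc]
      _ = _ := by simp only [Matrix.mul_assoc]

theorem eq_zero_of_eq_zero_on_unitary (hF : F ∈ polyFun N)
    (h : ∀ U ∈ unitaryGroup (Fin N) ℂ, F U = 0) : F = 0 := by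
  have key : ∀ A : Matrix (Fin N) (Fin N) ℂ, IsUnit A.det → F A = 0 := by
    intro A hA
    obtain ⟨V, hV, W, hW, x, rfl⟩ := exists_unitary_mul_diagonal_mul_unitary hA
    refine mul_diagonal_mul_eq_zero hF V W infinite_unit_complex (fun y hy => h _ ?_) x
    refine mul_mem (mul_mem hV ?_) hW
    rw [mem_unitaryGroup_iff', star_eq_conjTranspose, diagonal_conjTranspose, diagonal_mul_diagonal,
      ← diagonal_one]
    congr 1
    ext i
    exact hy i
  obtain ⟨p, hp⟩ := exists_eval_entries hF
  obtain ⟨q, hq⟩ := exists_eval_entries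
    (det_mem_polyFun (N := N) (M := fun X => X) fun i j => entry_mem_polyFun i j)
  have hpq : p * q = 0 := MvPolynomial.funext fun x => by
    have h1 := hp (Matrix.of fun i j => x (i, j))
    have h2 := hq (Matrix.of fun i j => x (i, j))
    simp only [of_apply] at h1 h2
    rw [map_mul, ← h1, ← h2, map_zero]
    by_cases hd : (Matrix.of fun i j => x (i, j)).det = 0
    · rw [hd, mul_zero]
    · rw [key _ (isUnit_iff_ne_zero.mpr hd), zero_mul]
  have hq0 : q ≠ 0 := fun h0 => by
    have := hq 1
    simp [h0] at this
  ext X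
  rw [hp, (mul_eq_zero.mp hpq).resolve_right hq0, map_zero, Pi.zero_apply]

/-- A homogeneous polynomial function vanishing on `SU(N)` vanishes. -/
theorem eq_zero_of_eq_zero_on_SUN (hN : 1 ≤ N) (hF : F ∈ polyFun N) {n : ℕ}
    (hn : ∀ (c : ℂ) X, F (c • X) = c ^ n * F X)
    (h : ∀ V : SUN N, F ((V : UN N) : Matrix (Fin N) (Fin N) ℂ) = 0) : F = 0 := by
  refine eq_zero_of_eq_zero_on_unitary hF fun U hU => ?_
  obtain ⟨c, hc⟩ := IsAlgClosed.exists_pow_nat_eq U.det hN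
  have hdet : star U.det * U.det = 1 := (Unitary.mem_iff.mp (det_of_mem_unitary hU)).1
  have hc1 : star c * c = 1 := by
    have h1 : (star c * c) ^ N = 1 := by rw [mul_pow, ← star_pow, hc, hdet]
    have h2 : star c * c = ((Complex.normSq c : ℝ) : ℂ) := by
      rw [mul_comm]; exact Complex.mul_conj c
    rw [h2] at h1 ⊢
    have h3 : (Complex.normSq c) ^ N = 1 := by exact_mod_cast h1
    exact_mod_cast (pow_eq_one_iff_of_nonneg (Complex.normSq_nonneg c) (by omega)).mp h3
  have hU1 : star U * U = 1 := mem_unitaryGroup_iff'.mp hU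
  have hV : star c • U ∈ unitaryGroup (Fin N) ℂ := by
    rw [mem_unitaryGroup_iff', star_smul, smul_mul_smul_comm, hU1, star_star, mul_comm, hc1,
      one_smul]
  have hV1 : (star c • U).det = 1 := by
    rw [det_smul, Fintype.card_fin, ← hc, ← mul_pow, hc1, one_pow]
  have h1 : F (star c • U) = 0 := h ⟨⟨_, hV⟩, hV1⟩
  have h2 : U = c • (star c • U) := by rw [smul_smul, mul_comm, hc1, one_smul]
  rw [h2, hn, h1, mul_zero]

theorem eq_zero_of_eq_zero_on_posDef (hF : F ∈ polyFun N)
    (h : ∀ S : Matrix (Fin N) (Fin N) ℂ, S.PosDef → F S = 0) : F = 0 := by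
  have key : ∀ H : Matrix (Fin N) (Fin N) ℂ, H.IsHermitian → F H = 0 := by
    intro H hH
    rw [hH.spectral_theorem, Unitary.conjStarAlgAut_apply]
    refine mul_diagonal_mul_eq_zero hF _ _ infinite_ofReal_pos (fun y hy => h _ ?_) _
    have hd : (diagonal y).PosDef := PosDef.diagonal fun t => by
      obtain ⟨r, hr, hr'⟩ := hy t
      rw [← hr']
      exact Complex.zero_lt_real.mpr hr
    have hu : IsUnit (hH.eigenvectorUnitary : Matrix (Fin N) (Fin N) ℂ) :=
      (Unitary.toUnits hH.eigenvectorUnitary).isUnit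
    exact (hu.posDef_star_right_conjugate_iff).mpr hd
  ext X
  have hX : X = (1 / 2 : ℂ) • (X + Xᴴ) + Complex.I • ((-Complex.I / 2) • (X - Xᴴ)) := by
    rw [smul_smul]
    have : Complex.I * (-Complex.I / 2) = 1 / 2 := by
      linear_combination (-1 / 2 : ℂ) * Complex.I_mul_I
    rw [this]
    module
  have hH : ((1 / 2 : ℂ) • (X + Xᴴ)).IsHermitian := by
    rw [IsHermitian, conjTranspose_smul, conjTranspose_add, conjTranspose_conjTranspose, add_comm]
    simp
  have hK : ((-Complex.I / 2 : ℂ) • (X - Xᴴ)).IsHermitian := by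
    rw [IsHermitian, conjTranspose_smul, conjTranspose_sub, conjTranspose_conjTranspose,
      ← neg_sub, smul_neg, ← neg_smul]
    congr 1
    simp [neg_div]
  set H := (1 / 2 : ℂ) • (X + Xᴴ)
  set K := (-Complex.I / 2 : ℂ) • (X - Xᴴ)
  have := eq_zero_of_forall_mem_infinite hF (τ := Unit) (M := fun x => H + x () • K)
    (fun i j => ⟨MvPolynomial.C (H i j) + MvPolynomial.X () * MvPolynomial.C (K i j), by simp⟩)
    infinite_ofReal_pos (fun x hx => key _ ?_) fun _ => Complex.I
  · rw [hX]; exact this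
  · obtain ⟨r, -, hr⟩ := hx ()
    refine hH.add ?_
    rw [IsHermitian, conjTranspose_smul, hK.eq, ← hr]
    simp

end Density

section Haar

variable {N : ℕ}

instance (N : ℕ) : BorelSpace (SUN N) := ⟨rfl⟩

/-- The inclusion of `SU(N)` in the monoid of matrices. -/
def toMat : SUN N →* Matrix (Fin N) (Fin N) ℂ :=
  (unitaryGroup (Fin N) ℂ).subtype.comp (SUN N).subtype

theorem toMat_apply (V : SUN N) : toMat V = ((V : UN N) : Matrix (Fin N) (Fin N) ℂ) := rfl

@[simp] theorem toMat_inv (V : SUN N) : toMat V⁻¹ = (toMat V)ᴴ := rfl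

theorem toMat_mul_conjTranspose (V : SUN N) : toMat V * (toMat V)ᴴ = 1 := by
  rw [← toMat_inv, ← map_mul, mul_inv_cancel, map_one]

theorem conjTranspose_mul_toMat (V : SUN N) : (toMat V)ᴴ * toMat V = 1 := by
  rw [← toMat_inv, ← map_mul, inv_mul_cancel, map_one]

theorem continuous_toMat : Continuous (toMat (N := N)) :=
  continuous_subtype_val.comp continuous_subtype_val

theorem isClosedEmbedding_toMat : Topology.IsClosedEmbedding (toMat (N := N)) := by
  refine ⟨Topology.IsEmbedding.subtypeVal.comp Topology.IsEmbedding.subtypeVal, ?_⟩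
  have : Set.range (toMat (N := N)) =
      (unitary (Matrix (Fin N) (Fin N) ℂ) : Set _) ∩ {X | X.det = 1} := by
    ext X
    constructor
    · rintro ⟨V, rfl⟩
      exact ⟨V.1.2, V.2⟩
    · rintro ⟨h1, h2⟩
      exact ⟨⟨⟨X, h1⟩, h2⟩, rfl⟩
  rw [this]
  exact isClosed_unitary.inter (isClosed_eq (Continuous.matrix_det continuous_id) continuous_const)

instance (N : ℕ) : CompactSpace (SUN N) := by
  refine ⟨?_⟩
  rw [isClosedEmbedding_toMat.isEmbedding.isCompact_iff, Set.image_univ]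
  have hK : IsCompact (Set.univ.pi fun _ : Fin N => Set.univ.pi fun _ : Fin N =>
      Metric.closedBall (0 : ℂ) 1) :=
    isCompact_univ_pi fun _ => isCompact_univ_pi fun _ => isCompact_closedBall _ _
  refine hK.of_isClosed_subset isClosedEmbedding_toMat.isClosed_range ?_
  rintro _ ⟨V, rfl⟩ i - j -
  rw [mem_closedBall_zero_iff]
  exact entry_norm_bound_of_unitary V.1.2 i j

variable (μ : Measure (SUN N)) [μ.IsHaarMeasure]

theorem integrable_of_continuous_SUN {f : SUN N → ℂ} (hf : Continuous f) : Integrable f μ :=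
  hf.integrable_of_hasCompactSupport (HasCompactSupport.of_compactSpace f)

theorem integral_conj_eq_self_SUN (f : SUN N → ℂ) (W : SUN N) :
    ∫ V, f (W * V * W⁻¹) ∂μ = ∫ V, f V ∂μ := by
  have hc : Continuous (MulAut.conj W).toMonoidHom := by
    change Continuous fun V => W * V * W⁻¹
    fun_prop
  have hmp := MonoidHom.measurePreserving (μ := μ) (ν := μ) hc (MulAut.conj W).surjective rfl
  have he : MeasurableEmbedding (MulAut.conj W).toMonoidHom :=
    (hc.isClosedEmbedding (MulAut.conj W).injective).measurableEmbedding
  exact hmp.integral_comp he f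

theorem integral_mul_right_eq_self_SUN (f : SUN N → ℂ) (W : SUN N) :
    ∫ V, f (V * W) ∂μ = ∫ V, f V ∂μ := by
  rw [← integral_conj_eq_self_SUN μ f W⁻¹,
    ← integral_mul_left_eq_self (fun V => f (W⁻¹ * V * W⁻¹⁻¹)) W]
  simp

theorem integral_swap_SUN {f : SUN N → SUN N → ℂ} (hf : Continuous f.uncurry) :
    ∫ V, ∫ W, f V W ∂μ ∂μ = ∫ W, ∫ V, f V W ∂μ ∂μ :=
  integral_integral_swap_of_hasCompactSupport hf (HasCompactSupport.of_compactSpace _)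

theorem eq_zero_of_integral_mul_conj {f : SUN N → ℂ} (hf : Continuous f)
    (h : ∫ V, f V * (starRingEnd ℂ) (f V) ∂μ = 0) : f = 0 := by
  have h1 : ∫ V, Complex.normSq (f V) ∂μ = 0 := by
    have : ∫ V, ((Complex.normSq (f V) : ℝ) : ℂ) ∂μ = 0 := by
      simpa only [Complex.mul_conj] using h
    rw [integral_complex_ofReal] at this
    exact_mod_cast this
  have hc : Continuous fun V => Complex.normSq (f V) := Complex.continuous_normSq.comp hf
  have h2 := (integral_eq_zero_iff_of_nonneg (fun V => Complex.normSq_nonneg (f V))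
    (hc.integrable_of_hasCompactSupport (HasCompactSupport.of_compactSpace _))).mp h1
  have h3 := (hc.ae_eq_iff_eq μ continuous_const).mp h2
  ext V
  exact Complex.normSq_eq_zero.mp (congrFun h3 V)

end Haar

section Averaging

variable {N : ℕ} {p q : Matrix (Fin N) (Fin N) ℂ → ℂ} {n : ℕ}

/-- `F` is homogeneous of degree `n` as a function of a matrix. -/
def IsHomogOfDegree (F : Matrix (Fin N) (Fin N) ℂ → ℂ) (n : ℕ) : Prop :=
  ∀ (c : ℂ) X, F (c • X) = c ^ n * F X

theorem IsHomogOfDegree.comp_mul_right (h : IsHomogOfDegree p n) (A : Matrix (Fin N) (Fin N) ℂ) :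
    IsHomogOfDegree (fun X => p (X * A)) n := fun c X => by
  change p (c • X * A) = _
  rw [Matrix.smul_mul, h]

theorem IsHomogOfDegree.comp_mul_left (h : IsHomogOfDegree p n) (A : Matrix (Fin N) (Fin N) ℂ) :
    IsHomogOfDegree (fun X => p (A * X)) n := fun c X => by
  change p (A * c • X) = _
  rw [Matrix.mul_smul, h]

variable (μ : Measure (SUN N)) [μ.IsHaarMeasure]

theorem continuous_conjTranspose_toMat : Continuous fun V : SUN N => (toMat V)ᴴ :=
  continuous_toMat.matrix_conjTranspose

theorem integral_mul_left_mem_polyFun (hp : p ∈ polyFun N)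
    {M : SUN N → Matrix (Fin N) (Fin N) ℂ} (hM : Continuous M) {g : SUN N → ℂ}
    (hg : Continuous g) : (fun X => ∫ V, p (X * M V) * g V ∂μ) ∈ polyFun N := by
  obtain ⟨ι, _, a, b, ha, hb, h⟩ := exists_comul hp
  have : (fun X => ∫ V, p (X * M V) * g V ∂μ) =
      fun X => ∑ i, a i X * ∫ V, b i (M V) * g V ∂μ := by
    ext X
    simp only [h, Finset.sum_mul, mul_assoc]
    rw [integral_finsetSum]
    · simp only [integral_const_mul]
    · intro i _
      exact integrable_of_continuous_SUN μ
        (continuous_const.mul (((continuous_of_mem_polyFun (hb i)).comp hM).mul hg))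
  rw [this]
  exact sum_mem_polyFun _ fun i _ => (polyFun N).mul_mem (ha i) (const_mem_polyFun _)

theorem integral_mul_right_mem_polyFun (hp : p ∈ polyFun N)
    {M : SUN N → Matrix (Fin N) (Fin N) ℂ} (hM : Continuous M) {g : SUN N → ℂ}
    (hg : Continuous g) : (fun X => ∫ V, p (M V * X) * g V ∂μ) ∈ polyFun N := by
  obtain ⟨ι, _, a, b, ha, hb, h⟩ := exists_comul hp
  have : (fun X => ∫ V, p (M V * X) * g V ∂μ) =
      fun X => ∑ i, (∫ V, a i (M V) * g V ∂μ) * b i X := by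
    ext X
    simp only [h, Finset.sum_mul, mul_right_comm _ _ (g _)]
    rw [integral_finsetSum]
    · simp only [integral_mul_const]
    · intro i _
      exact integrable_of_continuous_SUN μ
        ((((continuous_of_mem_polyFun (ha i)).comp hM).mul hg).mul continuous_const)
  rw [this]
  exact sum_mem_polyFun _ fun i _ => (polyFun N).mul_mem (const_mem_polyFun _) (hb i)

theorem integral_mul_conjTranspose_mul (hN : 1 ≤ N) (hp : p ∈ polyFun N) (hq : q ∈ polyFun N)
    (hpn : IsHomogOfDegree p n) (hqn : IsHomogOfDegree q n) (A B : Matrix (Fin N) (Fin N) ℂ) :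
    ∫ V, p (A * toMat V) * q ((toMat V)ᴴ * B) ∂μ =
      ∫ V, p (toMat V) * q ((toMat V)ᴴ * (A * B)) ∂μ := by
  have hpc := continuous_of_mem_polyFun hp
  have hqc := continuous_of_mem_polyFun hq
  have hc := continuous_conjTranspose_toMat (N := N)
  have hR : (fun W => ∫ V, p (W * toMat V) * q ((toMat V)ᴴ * B) ∂μ) -
      (fun W => ∫ V, q ((toMat V)ᴴ * W * B) * p (toMat V) ∂μ) = 0 := by
    refine eq_zero_of_eq_zero_on_SUN hN (n := n) ((polyFun N).sub_mem ?_ ?_) ?_ ?_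
    · exact integral_mul_left_mem_polyFun μ hp continuous_toMat
        (hqc.comp (hc.matrix_mul continuous_const))
    · exact integral_mul_right_mem_polyFun μ (comp_mul_right_mem_polyFun hq B) hc
        (hpc.comp continuous_toMat)
    · intro c X
      simp only [Pi.sub_apply, Matrix.smul_mul, Matrix.mul_smul, hpn c, hqn c, mul_sub, mul_assoc,
        integral_const_mul]
    · intro W
      rw [← toMat_apply, Pi.sub_apply, sub_eq_zero,
        ← integral_mul_left_eq_self _ W⁻¹]
      refine integral_congr_ae (Filter.Eventually.of_forall fun V => ?_)
      simp only [map_mul, toMat_inv, conjTranspose_mul, conjTranspose_conjTranspose]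
      rw [← Matrix.mul_assoc, toMat_mul_conjTranspose, Matrix.one_mul, mul_comm]
  have := congrFun hR A
  simp only [Pi.sub_apply, Pi.zero_apply, sub_eq_zero] at this
  rw [this]
  simp only [mul_comm, Matrix.mul_assoc]

theorem integral_mul_mul_conjTranspose (hN : 1 ≤ N) (hp : p ∈ polyFun N) (hq : q ∈ polyFun N)
    (hpn : IsHomogOfDegree p n) (hqn : IsHomogOfDegree q n) (C D : Matrix (Fin N) (Fin N) ℂ) :
    ∫ V, p (toMat V * C) * q (D * (toMat V)ᴴ) ∂μ =
      ∫ V, p (toMat V) * q (D * C * (toMat V)ᴴ) ∂μ := by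
  have hpc := continuous_of_mem_polyFun hp
  have hqc := continuous_of_mem_polyFun hq
  have hc := continuous_conjTranspose_toMat (N := N)
  have hR : (fun W => ∫ V, p (toMat V * W) * q (D * (toMat V)ᴴ) ∂μ) -
      (fun W => ∫ V, q (D * (W * (toMat V)ᴴ)) * p (toMat V) ∂μ) = 0 := by
    refine eq_zero_of_eq_zero_on_SUN hN (n := n) ((polyFun N).sub_mem ?_ ?_) ?_ ?_
    · exact integral_mul_right_mem_polyFun μ hp continuous_toMat
        (hqc.comp (continuous_const.matrix_mul hc))
    · exact integral_mul_left_mem_polyFun μ (comp_mul_left_mem_polyFun hq D) hc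
        (hpc.comp continuous_toMat)
    · intro c X
      simp only [Pi.sub_apply, Matrix.smul_mul, Matrix.mul_smul, hpn c, hqn c, mul_sub, mul_assoc,
        integral_const_mul]
    · intro W
      rw [← toMat_apply, Pi.sub_apply, sub_eq_zero,
        ← integral_mul_right_eq_self_SUN μ _ W⁻¹]
      refine integral_congr_ae (Filter.Eventually.of_forall fun V => ?_)
      simp only [map_mul, toMat_inv, conjTranspose_mul, conjTranspose_conjTranspose]
      rw [Matrix.mul_assoc, conjTranspose_mul_toMat, Matrix.mul_one, mul_comm]
  have := congrFun hR C
  simp only [Pi.sub_apply, Pi.zero_apply, sub_eq_zero] at this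
  rw [this]
  simp only [mul_comm, Matrix.mul_assoc]

theorem integral_two_sided (hN : 1 ≤ N) (hp : p ∈ polyFun N) (hq : q ∈ polyFun N)
    (hpn : IsHomogOfDegree p n) (hqn : IsHomogOfDegree q n) (A B C D : Matrix (Fin N) (Fin N) ℂ) :
    ∫ V, p (A * toMat V * C) * q (D * (toMat V)ᴴ * B) ∂μ =
      ∫ V, p (toMat V) * q (D * C * (toMat V)ᴴ * (A * B)) ∂μ := by
  have h1 := integral_mul_conjTranspose_mul μ hN (comp_mul_right_mem_polyFun hp C)
    (comp_mul_left_mem_polyFun hq D) (n := n) (hpn.comp_mul_right C)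
    (hqn.comp_mul_left D) A B
  have h2 := integral_mul_mul_conjTranspose μ hN hp
    (comp_mul_right_mem_polyFun hq (A * B)) (n := n) hpn
    (hqn.comp_mul_right _) C D
  simp only [Matrix.mul_assoc] at h1 h2 ⊢
  rw [h1, h2]

end Averaging

section HighestWeight

variable {N : ℕ}

/-- The leading principal minor on the indices `≤ k`. -/
def leadMinor (k : Fin N) (X : Matrix (Fin N) (Fin N) ℂ) : ℂ :=
  (X.toSquareBlockProp (· ≤ k)).det

/-- The value of the partition `l` at an arbitrary index, extended by zero. -/
def extPart (l : Fin N → ℕ) (m : ℕ) : ℕ := if h : m < N then l ⟨m, h⟩ else 0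

/-- The difference of two consecutive parts. -/
def partGap (l : Fin N → ℕ) (m : ℕ) : ℕ := extPart l m - extPart l (m + 1)

/-- The highest weight vector: a product of powers of leading principal minors. -/
def leadProd (l : Fin N → ℕ) (X : Matrix (Fin N) (Fin N) ℂ) : ℂ :=
  ∏ k : Fin N, leadMinor k X ^ partGap l k

theorem sum_partGap {l : Fin N → ℕ} (hl : Antitone l) (i : Fin N) :
    ∑ k : Fin N, (if i ≤ k then partGap l k else 0) = l i := by
  have hstep : ∀ m, extPart l (m + 1) ≤ extPart l m := by
    intro m
    unfold extPart
    split_ifs with h1 h2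
    · exact hl (Fin.mk_le_mk.mpr (Nat.le_succ m))
    · omega
    · exact Nat.zero_le _
    · exact le_rfl
  have key : ∀ m, (i : ℕ) ≤ m →
      ∑ k ∈ Finset.Ico (i : ℕ) m, partGap l k + extPart l m = extPart l i := by
    intro m hm
    induction m, hm using Nat.le_induction with
    | base => simp
    | succ m hm ih =>
      rw [Finset.sum_Ico_succ_top hm, ← ih, partGap]
      have := hstep m
      omega
  have h1 := key N i.2.le
  have h2 : extPart l N = 0 := by simp [extPart]
  have h3 : extPart l i = l i := dif_pos i.2
  rw [h2, h3, add_zero] at h1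
  rw [← h1]
  have := Fin.sum_univ_eq_sum_range (fun k : ℕ => if (i : ℕ) ≤ k then partGap l k else 0) N
  simp only [Fin.val_fin_le] at this
  rw [this, ← Finset.sum_filter]
  congr 1
  ext k
  simp [and_comm]

theorem leadMinor_mul_upper (k : Fin N) (X : Matrix (Fin N) (Fin N) ℂ)
    {R : Matrix (Fin N) (Fin N) ℂ} (hR : ∀ i j, j < i → R i j = 0) :
    leadMinor k (X * R) = leadMinor k X * leadMinor k R := by
  rw [leadMinor, leadMinor, leadMinor, ← det_mul]
  congr 1
  ext i j
  change ∑ t, X i t * R t j = ∑ t : {t // t ≤ k}, X i t * R t j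
  rw [← Finset.sum_subtype (Finset.univ.filter (· ≤ k)) (by simp) fun t => X i t * R t j]
  refine (Finset.sum_subset (Finset.subset_univ _) fun t _ ht => ?_).symm
  rw [hR t j (lt_of_le_of_lt j.2 (by simpa using ht)), mul_zero]

theorem leadMinor_transpose (k : Fin N) (X : Matrix (Fin N) (Fin N) ℂ) :
    leadMinor k Xᵀ = leadMinor k X := by
  rw [leadMinor, leadMinor, ← det_transpose]
  rfl

theorem leadMinor_conjTranspose (k : Fin N) (X : Matrix (Fin N) (Fin N) ℂ) :
    leadMinor k Xᴴ = (starRingEnd ℂ) (leadMinor k X) := by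
  have := det_conjTranspose (X.toSquareBlockProp (· ≤ k))
  exact this

theorem leadMinor_diagonal (k : Fin N) (d : Fin N → ℂ) :
    leadMinor k (diagonal d) = ∏ i : Fin N, if i ≤ k then d i else 1 := by
  have : (diagonal d).toSquareBlockProp (· ≤ k) = diagonal fun i : {i // i ≤ k} => d i := by
    ext i j
    simp [toSquareBlockProp_def, diagonal_apply, Subtype.ext_iff]
  rw [leadMinor, this, det_diagonal, ← Finset.prod_filter]
  exact (Finset.prod_subtype _ (by simp) _).symm

variable (l : Fin N → ℕ)

theorem leadProd_mul_upper (X : Matrix (Fin N) (Fin N) ℂ)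
    {R : Matrix (Fin N) (Fin N) ℂ} (hR : ∀ i j, j < i → R i j = 0) :
    leadProd l (X * R) = leadProd l X * leadProd l R := by
  simp only [leadProd, leadMinor_mul_upper _ X hR, mul_pow, Finset.prod_mul_distrib]

theorem leadProd_transpose (X : Matrix (Fin N) (Fin N) ℂ) :
    leadProd l Xᵀ = leadProd l X := by
  simp only [leadProd, leadMinor_transpose]

theorem leadProd_lower_mul (X : Matrix (Fin N) (Fin N) ℂ)
    {L : Matrix (Fin N) (Fin N) ℂ} (hL : ∀ i j, i < j → L i j = 0) :
    leadProd l (L * X) = leadProd l L * leadProd l X := by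
  rw [← leadProd_transpose, transpose_mul, leadProd_mul_upper l Xᵀ (R := Lᵀ) fun i j h => hL j i h,
    leadProd_transpose, leadProd_transpose, mul_comm]

theorem leadProd_conjTranspose (X : Matrix (Fin N) (Fin N) ℂ) :
    leadProd l Xᴴ = (starRingEnd ℂ) (leadProd l X) := by
  simp only [leadProd, leadMinor_conjTranspose, map_prod, map_pow]

theorem leadProd_diagonal {l : Fin N → ℕ} (hl : Antitone l) (d : Fin N → ℂ) :
    leadProd l (diagonal d) = ∏ i, d i ^ l i := by
  simp only [leadProd, leadMinor_diagonal, ← Finset.prod_pow]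
  rw [Finset.prod_comm]
  refine Finset.prod_congr rfl fun i _ => ?_
  rw [← sum_partGap hl i, ← Finset.prod_pow_eq_pow_sum]
  refine Finset.prod_congr rfl fun k _ => ?_
  split_ifs <;> simp

theorem leadProd_one {l : Fin N → ℕ} (hl : Antitone l) : leadProd l 1 = 1 := by
  rw [← diagonal_one, leadProd_diagonal hl]
  simp

theorem leadProd_homog {l : Fin N → ℕ} (hl : Antitone l) :
    IsHomogOfDegree (leadProd l) (∑ i, l i) := by
  intro c X
  have : c • X = X * diagonal fun _ => c := by
    ext i j
    simp [mul_comm]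
  rw [this, leadProd_mul_upper l X fun i j h => diagonal_apply_ne _ h.ne', leadProd_diagonal hl,
    Finset.prod_pow_eq_pow_sum, mul_comm]

theorem leadProd_mem_polyFun : leadProd l ∈ polyFun N := by
  refine prod_mem_polyFun _ fun k _ => (polyFun N).pow_mem ?_ _
  exact det_mem_polyFun fun i j => entry_mem_polyFun _ _

open scoped ComplexOrder in
theorem exists_lower_mul_diagonal_mul {S : Matrix (Fin N) (Fin N) ℂ} (hS : S.PosDef) :
    ∃ (L R : Matrix (Fin N) (Fin N) ℂ) (d : Fin N → ℂ), (∀ i j, i < j → L i j = 0) ∧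
      (∀ i j, j < i → R i j = 0) ∧ S = L * diagonal d * R := by
  have hL : ∀ i j, i < j → LDL.lower hS i j = 0 := fun i j h =>
    blockTriangular_inv_of_blockTriangular (M := LDL.lowerInv hS) (b := OrderDual.toDual)
      (fun i j h => LDL.lowerInv_triangular hS h) h
  refine ⟨LDL.lower hS, (LDL.lower hS)ᴴ, LDL.diagEntries hS, hL, fun i j h => ?_,
    (LDL.lower_conj_diag hS).symm⟩
  rw [conjTranspose_apply, hL j i h, star_zero]

open scoped ComplexOrder in
/-- A polynomial function with the semi-invariance of the highest weight vector is a multiple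
of it. -/
theorem eq_leadProd_of_semiInvariant {l : Fin N → ℕ}
    {q : Matrix (Fin N) (Fin N) ℂ → ℂ} (hq : q ∈ polyFun N)
    (hL : ∀ L X : Matrix (Fin N) (Fin N) ℂ, (∀ i j, i < j → L i j = 0) →
      q (L * X) = leadProd l L * q X)
    (hR : ∀ X R : Matrix (Fin N) (Fin N) ℂ, (∀ i j, j < i → R i j = 0) →
      q (X * R) = q X * leadProd l R) (X : Matrix (Fin N) (Fin N) ℂ) :
    q X = q 1 * leadProd l X := by
  have hz : q - (fun X => q 1 * leadProd l X) = 0 := by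
    refine eq_zero_of_eq_zero_on_posDef ((polyFun N).sub_mem hq
      ((polyFun N).mul_mem (const_mem_polyFun _) (leadProd_mem_polyFun l))) fun S hS => ?_
    obtain ⟨L, R, d, h1, h2, rfl⟩ := exists_lower_mul_diagonal_mul hS
    have h3 := hR 1 R h2
    have h4 := leadProd_mul_upper l 1 h2
    rw [Matrix.one_mul] at h3 h4
    have h5 : ∀ i j : Fin N, i < j → diagonal d i j = 0 := fun i j h => diagonal_apply_ne _ h.ne
    rw [Pi.sub_apply, Matrix.mul_assoc, hL _ _ h1, hL _ _ h5, h3, leadProd_lower_mul l _ h1,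
      leadProd_lower_mul l _ h5]
    ring
  exact sub_eq_zero.mp (congrFun hz X)

variable (μ : Measure (SUN N)) [μ.IsHaarMeasure]

/-- The squared norm of the highest weight vector. -/
def leadNorm : ℂ := ∫ V, leadProd l (toMat V) * leadProd l (toMat V)ᴴ ∂μ

theorem integral_leadProd_mul (hN : 1 ≤ N) {l : Fin N → ℕ} (hl : Antitone l)
    (A B C D : Matrix (Fin N) (Fin N) ℂ) :
    ∫ V, leadProd l (A * toMat V * C) * leadProd l (D * (toMat V)ᴴ * B) ∂μ =
      leadNorm l μ * leadProd l (A * B) * leadProd l (D * C) := by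
  have hp := leadProd_mem_polyFun l
  have hh := leadProd_homog hl
  have hc := continuous_conjTranspose_toMat (N := N)
  have hpc := (continuous_of_mem_polyFun hp).comp (continuous_toMat (N := N))
  have key := integral_two_sided μ hN hp hp hh hh
  have h1 : ∀ P Q, ∫ V, leadProd l (toMat V) * leadProd l (Q * (toMat V)ᴴ * P) ∂μ =
      (∫ V, leadProd l (toMat V) * leadProd l (Q * (toMat V)ᴴ) ∂μ) * leadProd l P := by
    intro P Q
    have := eq_leadProd_of_semiInvariant (l := l)
      (q := fun P => ∫ V, leadProd l (toMat V) * leadProd l (Q * (toMat V)ᴴ * P) ∂μ) ?_ ?_ ?_ P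
    · simpa using this
    · simp only [mul_comm (leadProd l (toMat _))]
      exact integral_mul_right_mem_polyFun μ hp (continuous_const.matrix_mul hc) hpc
    · intro L X hL
      have := key L X 1 Q
      simp only [Matrix.mul_one] at this
      rw [← this]
      simp only [leadProd_lower_mul l _ hL, mul_assoc (leadProd l L), integral_const_mul]
    · intro X R hR
      rw [← integral_mul_const]
      refine integral_congr_ae (Filter.Eventually.of_forall fun V => ?_)
      change leadProd l (toMat V) * leadProd l (Q * (toMat V)ᴴ * (X * R)) = _
      rw [← Matrix.mul_assoc _ X R, leadProd_mul_upper l _ hR]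
      exact (mul_assoc _ _ _).symm
  have h2 : ∀ Q, ∫ V, leadProd l (toMat V) * leadProd l (Q * (toMat V)ᴴ) ∂μ =
      leadNorm l μ * leadProd l Q := by
    intro Q
    have := eq_leadProd_of_semiInvariant (l := l)
      (q := fun Q => ∫ V, leadProd l (toMat V) * leadProd l (Q * (toMat V)ᴴ) ∂μ) ?_ ?_ ?_ Q
    · simpa [leadNorm] using this
    · simp only [mul_comm (leadProd l (toMat _))]
      exact integral_mul_left_mem_polyFun μ hp hc hpc
    · intro L X hL
      simp only [Matrix.mul_assoc, leadProd_lower_mul l _ hL, mul_left_comm _ (leadProd l L),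
        integral_const_mul]
    · intro X R hR
      have := key 1 1 R X
      simp only [Matrix.mul_one, Matrix.one_mul] at this
      simp only [← this, leadProd_mul_upper l _ hR, mul_right_comm _ (leadProd l R),
        integral_mul_const]
  rw [key, h1, h2]
  ring

end HighestWeight

section Averaged

variable {N : ℕ} (l : Fin N → ℕ) (μ : Measure (SUN N)) [μ.IsHaarMeasure]

theorem integral_mul_mul_mem_polyFun {p : Matrix (Fin N) (Fin N) ℂ → ℂ} (hp : p ∈ polyFun N)
    {M M' : SUN N → Matrix (Fin N) (Fin N) ℂ} (hM : Continuous M) (hM' : Continuous M') :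
    (fun X => ∫ V, p (M V * X * M' V) ∂μ) ∈ polyFun N := by
  obtain ⟨ι, _, a, b, ha, hb, h⟩ := exists_comul hp
  have : (fun X => ∫ V, p (M V * X * M' V) ∂μ) =
      fun X => ∑ i, ∫ V, b i (X * M' V) * a i (M V) ∂μ := by
    ext X
    simp only [h, Matrix.mul_assoc]
    rw [integral_finsetSum]
    · simp only [mul_comm]
    · intro i _
      exact integrable_of_continuous_SUN μ (((continuous_of_mem_polyFun (ha i)).comp hM).mul
        ((continuous_of_mem_polyFun (hb i)).comp (continuous_const.matrix_mul hM')))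
  rw [this]
  exact sum_mem_polyFun _ fun i _ => integral_mul_left_mem_polyFun μ (hb i) hM'
    ((continuous_of_mem_polyFun (ha i)).comp hM)

/-- The average of the highest weight vector over unitary conjugation. -/
def avgLead (X : Matrix (Fin N) (Fin N) ℂ) : ℂ :=
  ∫ W, leadProd l (toMat W * X * (toMat W)ᴴ) ∂μ

theorem avgLead_mem_polyFun : avgLead l μ ∈ polyFun N :=
  integral_mul_mul_mem_polyFun μ (leadProd_mem_polyFun l) continuous_toMat
    continuous_conjTranspose_toMat

omit [μ.IsHaarMeasure] in
theorem avgLead_homog {l : Fin N → ℕ} (hl : Antitone l) :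
    IsHomogOfDegree (avgLead l μ) (∑ i, l i) := fun c X => by
  simp only [avgLead, Matrix.mul_smul, Matrix.smul_mul, leadProd_homog hl c, integral_const_mul]

theorem avgLead_conj (V : SUN N) (X : Matrix (Fin N) (Fin N) ℂ) :
    avgLead l μ (toMat V * X * (toMat V)ᴴ) = avgLead l μ X := by
  rw [avgLead, avgLead, ← integral_mul_right_eq_self_SUN μ
    (fun W => leadProd l (toMat W * X * (toMat W)ᴴ)) V]
  simp only [map_mul, conjTranspose_mul, Matrix.mul_assoc]

theorem avgLead_mul_comm (V : SUN N) (X : Matrix (Fin N) (Fin N) ℂ) :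
    avgLead l μ (toMat V * X) = avgLead l μ (X * toMat V) := by
  rw [← avgLead_conj l μ V (X * toMat V), Matrix.mul_assoc, Matrix.mul_assoc,
    toMat_mul_conjTranspose, Matrix.mul_one]

omit [μ.IsHaarMeasure] in
theorem avgLead_conjTranspose (X : Matrix (Fin N) (Fin N) ℂ) :
    avgLead l μ Xᴴ = (starRingEnd ℂ) (avgLead l μ X) := by
  rw [avgLead, avgLead, ← integral_conj]
  simp only [← leadProd_conjTranspose, conjTranspose_mul, conjTranspose_conjTranspose,
    Matrix.mul_assoc]

theorem integral_avgLead_mul_leadProd (hN : 1 ≤ N) {l : Fin N → ℕ} (hl : Antitone l)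
    (A B : Matrix (Fin N) (Fin N) ℂ) :
    ∫ V, avgLead l μ (A * toMat V) * leadProd l ((toMat V)ᴴ * B) ∂μ =
      leadNorm l μ ^ 2 * leadProd l (A * B) := by
  have hp := continuous_of_mem_polyFun (leadProd_mem_polyFun l)
  have hT := continuous_toMat (N := N)
  have hc := continuous_conjTranspose_toMat (N := N)
  simp only [avgLead, ← integral_mul_const]
  rw [integral_swap_SUN]
  · have h1 := fun W : SUN N => integral_leadProd_mul μ hN hl (toMat W * A) B (toMat W)ᴴ 1
    have h2 := integral_leadProd_mul μ hN hl 1 1 (A * B) 1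
    simp only [Matrix.one_mul, Matrix.mul_assoc, leadProd_one hl, mul_one] at h1 h2 ⊢
    simp only [h1, mul_assoc, integral_const_mul, h2]
    ring
  · refine Continuous.mul (hp.comp ?_) (hp.comp ?_)
    · exact ((hT.comp continuous_snd).matrix_mul (continuous_const.matrix_mul
        (hT.comp continuous_fst))).matrix_mul (hc.comp continuous_snd)
    · exact (hc.comp continuous_fst).matrix_mul continuous_const

theorem integral_avgLead_mul_avgLead (hN : 1 ≤ N) {l : Fin N → ℕ} (hl : Antitone l)
    (A B : Matrix (Fin N) (Fin N) ℂ) :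
    ∫ V, avgLead l μ (A * toMat V) * avgLead l μ ((toMat V)ᴴ * B) ∂μ =
      leadNorm l μ ^ 2 * avgLead l μ (A * B) := by
  have hp := continuous_of_mem_polyFun (leadProd_mem_polyFun l)
  have hψ := continuous_of_mem_polyFun (avgLead_mem_polyFun l μ)
  have hT := continuous_toMat (N := N)
  have hc := continuous_conjTranspose_toMat (N := N)
  have h1 : ∀ V : SUN N, avgLead l μ (A * toMat V) * avgLead l μ ((toMat V)ᴴ * B) =
      ∫ W, avgLead l μ (A * toMat V) *
        leadProd l (toMat W * ((toMat V)ᴴ * B) * (toMat W)ᴴ) ∂μ := fun V => by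
    rw [integral_const_mul, avgLead, avgLead]
  simp only [h1]
  rw [integral_swap_SUN]
  · rw [avgLead, ← integral_const_mul]
    congr 1
    ext W
    have h2 := integral_avgLead_mul_leadProd μ hN hl (toMat W * A) (B * (toMat W)ᴴ)
    rw [← Matrix.mul_assoc (toMat W * A), Matrix.mul_assoc (toMat W) A B] at h2
    have h3 : ∀ V : SUN N, avgLead l μ (A * toMat (V * W)) *
        leadProd l (toMat W * ((toMat (V * W))ᴴ * B) * (toMat W)ᴴ) =
        avgLead l μ (toMat W * A * toMat V) * leadProd l ((toMat V)ᴴ * (B * (toMat W)ᴴ)) := by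
      intro V
      have e1 : avgLead l μ (A * toMat (V * W)) = avgLead l μ (toMat W * A * toMat V) := by
        rw [map_mul, ← Matrix.mul_assoc, ← avgLead_mul_comm, ← Matrix.mul_assoc]
      have e2 : toMat W * ((toMat (V * W))ᴴ * B) * (toMat W)ᴴ =
          (toMat V)ᴴ * (B * (toMat W)ᴴ) := by
        rw [map_mul, conjTranspose_mul, Matrix.mul_assoc, Matrix.mul_assoc, Matrix.mul_assoc,
          ← Matrix.mul_assoc (toMat W), toMat_mul_conjTranspose, Matrix.one_mul]
      rw [e1, e2]
    rw [← h2, ← integral_mul_right_eq_self_SUN μ (fun V => avgLead l μ (A * toMat V) *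
        leadProd l (toMat W * ((toMat V)ᴴ * B) * (toMat W)ᴴ)) W]
    simp only [h3]
  · refine Continuous.mul (hψ.comp ?_) (hp.comp ?_)
    · exact continuous_const.matrix_mul (hT.comp continuous_fst)
    · exact ((hT.comp continuous_snd).matrix_mul ((hc.comp continuous_fst).matrix_mul
        continuous_const)).matrix_mul (hc.comp continuous_snd)

theorem integral_central_mul_avgLead [IsProbabilityMeasure μ]
    {s : Matrix (Fin N) (Fin N) ℂ → ℂ} (hs : s ∈ polyFun N)
    (hcen : ∀ X Y, s (X * Y) = s (Y * X)) :
    ∫ V, s (toMat V) * avgLead l μ (toMat V)ᴴ ∂μ =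
      ∫ V, s (toMat V) * leadProd l (toMat V)ᴴ ∂μ := by
  have hp := continuous_of_mem_polyFun (leadProd_mem_polyFun l)
  have hT := continuous_toMat (N := N)
  have hc := continuous_conjTranspose_toMat (N := N)
  simp only [avgLead, ← integral_const_mul]
  rw [integral_swap_SUN]
  · have h1 : ∀ W : SUN N, ∫ V, s (toMat V) * leadProd l (toMat W * (toMat V)ᴴ * (toMat W)ᴴ) ∂μ =
        ∫ V, s (toMat V) * leadProd l (toMat V)ᴴ ∂μ := by
      intro W
      rw [← integral_conj_eq_self_SUN μ (fun V => s (toMat V) * leadProd l (toMat V)ᴴ) W]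
      congr 1
      ext V
      simp only [map_mul, toMat_inv, conjTranspose_mul, conjTranspose_conjTranspose]
      rw [hcen (toMat W * toMat V), ← Matrix.mul_assoc (toMat W)ᴴ, conjTranspose_mul_toMat,
        Matrix.one_mul, ← Matrix.mul_assoc]
    simp only [h1, integral_const, probReal_univ, one_smul]
  · refine Continuous.mul ((continuous_of_mem_polyFun hs).comp (hT.comp continuous_fst))
      (hp.comp ?_)
    exact ((hT.comp continuous_snd).matrix_mul (hc.comp continuous_fst)).matrix_mul
      (hc.comp continuous_snd)

omit [μ.IsHaarMeasure] in
theorem conj_leadNorm : (starRingEnd ℂ) (leadNorm l μ) = leadNorm l μ := by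
  rw [leadNorm, ← integral_conj]
  simp only [map_mul, ← leadProd_conjTranspose, conjTranspose_conjTranspose, mul_comm]

theorem leadNorm_ne_zero {l : Fin N → ℕ} (hl : Antitone l) : leadNorm l μ ≠ 0 := by
  intro h
  simp only [leadNorm, leadProd_conjTranspose] at h
  have h0 := eq_zero_of_integral_mul_conj μ
    ((continuous_of_mem_polyFun (leadProd_mem_polyFun l)).comp continuous_toMat) h
  have := congrFun h0 1
  simp [leadProd_one hl] at this

/-- The convolution formula for an irreducible character, characterised by its norm and its pairing
with the highest weight vector. -/
theorem integral_mul_eq_div_of_pairing [IsProbabilityMeasure μ] (hN : 1 ≤ N) {l : Fin N → ℕ}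
    (hl : Antitone l) {s : Matrix (Fin N) (Fin N) ℂ → ℂ} (hs : s ∈ polyFun N)
    (hh : IsHomogOfDegree s (∑ i, l i)) (hcen : ∀ X Y, s (X * Y) = s (Y * X))
    (hconj : ∀ X, s Xᴴ = (starRingEnd ℂ) (s X))
    (h1 : ∫ V, s (toMat V) * s (toMat V)ᴴ ∂μ = 1)
    (h2 : ∫ V, s (toMat V) * leadProd l (toMat V)ᴴ ∂μ = leadNorm l μ)
    (A B : Matrix (Fin N) (Fin N) ℂ) :
    ∫ V, s (toMat V * A) * s ((toMat V)ᴴ * B) ∂μ = s (A * B) / s 1 := by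
  set c := leadNorm l μ with hcdef
  have hc0 : c ≠ 0 := leadNorm_ne_zero μ hl
  have hcc : (starRingEnd ℂ) c = c := conj_leadNorm l μ
  have hψm := avgLead_mem_polyFun l μ
  have hT := continuous_toMat (N := N)
  have hH := continuous_conjTranspose_toMat (N := N)
  have hsc := continuous_of_mem_polyFun hs
  have hψc := continuous_of_mem_polyFun hψm
  have h3 : ∫ V, s (toMat V) * avgLead l μ (toMat V)ᴴ ∂μ = c := by
    rw [integral_central_mul_avgLead l μ hs hcen, h2]
  have h4 : ∫ V, avgLead l μ (toMat V) * s (toMat V)ᴴ ∂μ = c := by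
    rw [← hcc, ← h3, ← integral_conj]
    simp only [map_mul, ← hconj, ← avgLead_conjTranspose, conjTranspose_conjTranspose, mul_comm]
  have hψ1 : avgLead l μ 1 = 1 := by
    simp [avgLead, toMat_mul_conjTranspose, leadProd_one hl]
  have h5 : ∫ V, avgLead l μ (toMat V) * avgLead l μ (toMat V)ᴴ ∂μ = c ^ 2 := by
    simpa [hψ1] using integral_avgLead_mul_avgLead μ hN hl 1 1
  have hE : (fun V : SUN N => c * s (toMat V) - avgLead l μ (toMat V)) = 0 := by
    refine eq_zero_of_integral_mul_conj μ
      ((continuous_const.mul (hsc.comp hT)).sub (hψc.comp hT)) ?_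
    have hexp : ∀ V : SUN N, (c * s (toMat V) - avgLead l μ (toMat V)) *
        (starRingEnd ℂ) (c * s (toMat V) - avgLead l μ (toMat V)) =
        (c ^ 2 * (s (toMat V) * s (toMat V)ᴴ) - c * (s (toMat V) * avgLead l μ (toMat V)ᴴ)) -
        (c * (avgLead l μ (toMat V) * s (toMat V)ᴴ) -
          avgLead l μ (toMat V) * avgLead l μ (toMat V)ᴴ) := by
      intro V
      rw [map_sub, map_mul, hcc, ← hconj, ← avgLead_conjTranspose]
      ring
    have i1 : Integrable (fun V => c ^ 2 * (s (toMat V) * s (toMat V)ᴴ)) μ :=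
      integrable_of_continuous_SUN μ
      ((continuous_const (y := c ^ 2)).mul ((hsc.comp hT).mul (hsc.comp hH)))
    have i2 : Integrable (fun V => c * (s (toMat V) * avgLead l μ (toMat V)ᴴ)) μ :=
      integrable_of_continuous_SUN μ
      ((continuous_const (y := c)).mul ((hsc.comp hT).mul (hψc.comp hH)))
    have i3 : Integrable (fun V => c * (avgLead l μ (toMat V) * s (toMat V)ᴴ)) μ :=
      integrable_of_continuous_SUN μ
      ((continuous_const (y := c)).mul ((hψc.comp hT).mul (hsc.comp hH)))
    have i4 : Integrable (fun V => avgLead l μ (toMat V) * avgLead l μ (toMat V)ᴴ) μ :=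
      integrable_of_continuous_SUN μ ((hψc.comp hT).mul (hψc.comp hH))
    simp only [hexp]
    refine (integral_sub (i1.sub i2) (i3.sub i4)).trans ?_
    refine (congrArg₂ _ (integral_sub i1 i2) (integral_sub i3 i4)).trans ?_
    simp only [integral_const_mul, h1, h3, h4, h5]
    ring
  have hψs : ∀ X, avgLead l μ X = c * s X := by
    have : (fun X => c * s X) - avgLead l μ = 0 := by
      refine eq_zero_of_eq_zero_on_SUN hN
        ((polyFun N).sub_mem ((polyFun N).mul_mem (const_mem_polyFun c) hs) hψm)
        (n := ∑ i, l i) ?_ fun V => congrFun hE V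
      intro a X
      simp only [Pi.sub_apply, hh a, avgLead_homog μ hl a]
      ring
    intro X
    exact (sub_eq_zero.mp (congrFun this X)).symm
  have key : ∀ A B, ∫ V, s (toMat V * A) * s ((toMat V)ᴴ * B) ∂μ = c * s (A * B) := by
    intro A B
    have h6 := integral_avgLead_mul_avgLead μ hN hl A B
    simp only [hψs] at h6
    have h7 : ∀ V : SUN N, c * s (A * toMat V) * (c * s ((toMat V)ᴴ * B)) =
        c ^ 2 * (s (toMat V * A) * s ((toMat V)ᴴ * B)) := fun V => by
      rw [hcen A]; ring
    simp only [h7, integral_const_mul] at h6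
    exact mul_left_cancel₀ (pow_ne_zero 2 hc0) h6
  have h8 := key 1 1
  simp only [Matrix.mul_one, h1] at h8
  rw [key, eq_div_iff (fun h => by simp [h] at h8), mul_right_comm, ← h8, one_mul]

end Averaged

section Newton

open PowerSeries

/-- `F` is the generating series of the complete homogeneous symmetric functions whose power sums
are `p`: Newton's identities in the form `F' = (∑ₖ p (k+1) tᵏ) F`, `F 0 = 1`. -/
def IsNewton (p : ℕ → ℂ) (F : PowerSeries ℂ) : Prop :=
  coeff 0 F = 1 ∧ d⁄dX ℂ F = mk (fun k => p (k + 1)) * F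

theorem isNewton_iff {p : ℕ → ℂ} {F : PowerSeries ℂ} :
    IsNewton p F ↔ coeff 0 F = 1 ∧ ∀ k : ℕ, ((k : ℂ) + 1) * coeff (k + 1) F =
      ∑ m ∈ Finset.range (k + 1), p (m + 1) * coeff (k - m) F := by
  unfold IsNewton
  refine and_congr_right fun _ => ?_
  rw [PowerSeries.ext_iff]
  refine forall_congr' fun k => ?_
  rw [coeff_derivative, coeff_mul,
    Finset.Nat.sum_antidiagonal_eq_sum_range_succ
      (fun i j => coeff i (mk (fun k => p (k + 1))) * coeff j F), mul_comm]
  simp only [coeff_mk]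

theorem IsNewton.unique {p : ℕ → ℂ} {F G : PowerSeries ℂ} (hF : IsNewton p F)
    (hG : IsNewton p G) : F = G := by
  rw [isNewton_iff] at hF hG
  ext n
  induction n using Nat.strong_induction_on with
  | _ n ih =>
    rcases n with _ | k
    · rw [hF.1, hG.1]
    · have hk : (k : ℂ) + 1 ≠ 0 := Nat.cast_add_one_ne_zero k
      apply mul_left_cancel₀ hk
      rw [hF.2, hG.2]
      exact Finset.sum_congr rfl fun m _ => by rw [ih (k - m) (by omega)]

theorem IsNewton.mul {p q : ℕ → ℂ} {F G : PowerSeries ℂ} (hF : IsNewton p F)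
    (hG : IsNewton q G) : IsNewton (fun k => p k + q k) (F * G) := by
  refine ⟨by simp [coeff_mul, hF.1, hG.1], ?_⟩
  have h : (mk fun k => p (k + 1) + q (k + 1)) =
      (mk fun k => p (k + 1)) + mk fun k => q (k + 1) := by
    ext k
    simp
  rw [Derivation.leibniz, hF.2, hG.2, h, smul_eq_mul, smul_eq_mul]
  ring

theorem isNewton_zero : IsNewton (fun _ => 0) 1 := by
  refine ⟨by simp, ?_⟩
  have h : (mk fun _ => (0 : ℂ)) = 0 := by
    ext k
    simp
  rw [derivative_one, h, zero_mul]

theorem isNewton_prod {ι : Type*} (s : Finset ι) (p : ι → ℕ → ℂ) (F : ι → PowerSeries ℂ)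
    (h : ∀ i, IsNewton (p i) (F i)) : IsNewton (fun k => ∑ i ∈ s, p i k) (∏ i ∈ s, F i) := by
  induction s using Finset.induction_on with
  | empty => simpa using isNewton_zero
  | insert a s ha ih =>
    simp only [Finset.sum_insert ha, Finset.prod_insert ha]
    exact (h a).mul ih

theorem IsNewton.rescale {p : ℕ → ℂ} {F : PowerSeries ℂ} (hF : IsNewton p F) (d : ℂ) :
    IsNewton (fun k => d ^ k * p k) (PowerSeries.rescale d F) := by
  rw [isNewton_iff] at hF ⊢
  refine ⟨by rw [coeff_rescale, hF.1, pow_zero, one_mul], fun k => ?_⟩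
  rw [coeff_rescale, mul_left_comm, hF.2, Finset.mul_sum]
  refine Finset.sum_congr rfl fun m hm => ?_
  have h : k + 1 = (m + 1) + (k - m) := by
    have := Finset.mem_range.1 hm
    omega
  rw [coeff_rescale, h, pow_add]
  ring

theorem isNewton_mk_one : IsNewton (fun _ => 1) (mk 1) := by
  rw [isNewton_iff]
  refine ⟨by simp, fun k => ?_⟩
  simp

/-- The generating series of the complete homogeneous symmetric functions of a matrix. -/
def hSeries {N : ℕ} (X : Matrix (Fin N) (Fin N) ℂ) : PowerSeries ℂ := mk (hMat X)

theorem hMat_zero {N : ℕ} (X : Matrix (Fin N) (Fin N) ℂ) : hMat X 0 = 1 := by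
  rw [hMat]

theorem hMat_succ {N : ℕ} (X : Matrix (Fin N) (Fin N) ℂ) (k : ℕ) :
    hMat X (k + 1) = ((k : ℂ) + 1)⁻¹ *
      ∑ m ∈ Finset.range (k + 1), (X ^ (m + 1)).trace * hMat X (k - m) := by
  rw [hMat]

theorem isNewton_hSeries {N : ℕ} (X : Matrix (Fin N) (Fin N) ℂ) :
    IsNewton (fun k => (X ^ k).trace) (hSeries X) := by
  rw [isNewton_iff]
  refine ⟨by rw [hSeries, coeff_mk, hMat_zero], fun k => ?_⟩
  simp only [hSeries, coeff_mk]
  rw [hMat_succ, mul_inv_cancel_left₀ (Nat.cast_add_one_ne_zero k)]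

theorem hSeries_diagonal {N : ℕ} (d : Fin N → ℂ) :
    hSeries (diagonal d) = ∏ i, PowerSeries.rescale (d i) (mk 1) := by
  apply (isNewton_hSeries (diagonal d)).unique
  have h := isNewton_prod Finset.univ _ _ fun i => isNewton_mk_one.rescale (d i)
  convert h using 2 with k
  rw [diagonal_pow, trace_diagonal]
  simp

end Newton

section SymmetricPowerTrace

open MvPolynomial

variable {σ : Type} [Fintype σ]

/-- The linear substitution of variables `Xᵢ ↦ ∑ⱼ Mᵢⱼ Xⱼ`. -/
def linSubst (M : Matrix σ σ ℂ) : MvPolynomial σ ℂ →ₐ[ℂ] MvPolynomial σ ℂ :=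
  aeval fun i => ∑ j, C (M i j) * X j

theorem linSubst_X (M : Matrix σ σ ℂ) (i : σ) : linSubst M (X i) = ∑ j, C (M i j) * X j := by
  simp [linSubst]

variable [DecidableEq σ]

/-- The trace of (the degree `k` block of) a linear endomorphism of the polynomial ring. -/
def symTrace (k : ℕ) (D : MvPolynomial σ ℂ → MvPolynomial σ ℂ) : ℂ :=
  ∑ a ∈ Finset.finsuppAntidiag Finset.univ k, coeff a (D (monomial a 1))

theorem symTrace_succ_X_mul (k : ℕ) (j : σ) (E : MvPolynomial σ ℂ → MvPolynomial σ ℂ) :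
    symTrace (k + 1) (fun f => X j * E f) = symTrace k (fun f => E (X j * f)) := by
  unfold symTrace
  simp only [coeff_X_mul']
  rw [← Finset.sum_filter]
  symm
  refine Finset.sum_bij' (fun b _ => b + Finsupp.single j 1) (fun a _ => a - Finsupp.single j 1)
    ?_ ?_ ?_ ?_ ?_
  · intro b hb
    simp only [Finset.mem_finsuppAntidiag, Finset.mem_filter, Finset.subset_univ, and_true] at hb ⊢
    constructor
    · simp [Finset.sum_add_distrib, hb, Finsupp.single_apply]
    · simp
  · intro a ha
    simp only [Finset.mem_finsuppAntidiag, Finset.mem_filter, Finset.subset_univ, and_true] at ha ⊢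
    have hle : Finsupp.single j 1 ≤ a := by
      rw [Finsupp.single_le_iff]
      exact Nat.one_le_iff_ne_zero.2 (Finsupp.mem_support_iff.1 ha.2)
    have h : ∑ i, ((a - Finsupp.single j 1) + Finsupp.single j 1 : σ →₀ ℕ) i = k + 1 := by
      rw [tsub_add_cancel_of_le hle, ha.1]
    simp only [Finsupp.coe_add, Pi.add_apply, Finset.sum_add_distrib, Finsupp.single_apply,
      Finset.sum_ite_eq, Finset.mem_univ, if_true] at h
    exact Nat.succ_injective h
  · intro b _
    simp
  · intro a ha
    simp only [Finset.mem_filter] at ha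
    apply tsub_add_cancel_of_le
    rw [Finsupp.single_le_iff]
    exact Nat.one_le_iff_ne_zero.2 (Finsupp.mem_support_iff.1 ha.2)
  · intro b _
    simp only [add_tsub_cancel_right]
    rw [mul_comm, X, monomial_mul, one_mul]

/-- The weighted trace appearing in Euler's identity for `symTrace`. -/
def eulerTrace (M : Matrix σ σ ℂ) (k : ℕ) (B : Matrix σ σ ℂ) : ℂ :=
  ∑ i, ∑ j, B i j * symTrace k (fun f => X j * linSubst M (pderiv i f))

theorem symTrace_eq_eulerTrace (M : Matrix σ σ ℂ) (k : ℕ) :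
    (k : ℂ) * symTrace k (linSubst M) = eulerTrace M k M := by
  have h : ∀ a ∈ Finset.finsuppAntidiag (Finset.univ : Finset σ) k,
      (k : ℂ) * coeff a (linSubst M (monomial a 1)) =
        ∑ i, ∑ j, M i j * coeff a (X j * linSubst M (pderiv i (monomial a 1))) := by
    intro a ha
    have h1 : (k : ℂ) • (monomial a (1 : ℂ)) = ∑ i, X i * pderiv i (monomial a 1) := by
      simp only [X_mul_pderiv_monomial, ← Finset.sum_smul]
      rw [(Finset.mem_finsuppAntidiag.1 ha).1, Nat.cast_smul_eq_nsmul]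
    rw [← smul_eq_mul, ← coeff_smul, ← map_smul, h1, map_sum, coeff_sum]
    refine Finset.sum_congr rfl fun i _ => ?_
    rw [map_mul, linSubst_X, Finset.sum_mul, coeff_sum]
    refine Finset.sum_congr rfl fun j _ => ?_
    rw [mul_assoc, coeff_C_mul]
  unfold eulerTrace symTrace
  rw [Finset.mul_sum, Finset.sum_congr rfl h, Finset.sum_comm]
  refine Finset.sum_congr rfl fun i _ => ?_
  rw [Finset.sum_comm]
  simp only [Finset.mul_sum]

theorem eulerTrace_zero (M B : Matrix σ σ ℂ) : eulerTrace M 0 B = 0 := by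
  unfold eulerTrace symTrace
  simp

theorem eulerTrace_succ (M : Matrix σ σ ℂ) (k : ℕ) (B : Matrix σ σ ℂ) :
    eulerTrace M (k + 1) B = B.trace * symTrace k (linSubst M) + eulerTrace M k (B * M) := by
  have h : ∀ i j, symTrace (k + 1) (fun f => X j * linSubst M (pderiv i f)) =
      (if i = j then symTrace k (linSubst M) else 0) +
        ∑ r, M j r * symTrace k (fun f => X r * linSubst M (pderiv i f)) := by
    intro i j
    have h1 : ∀ f, linSubst M (pderiv i (X j * f)) =
        (if i = j then linSubst M f else 0) +
          ∑ r, C (M j r) * (X r * linSubst M (pderiv i f)) := by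
      intro f
      rw [pderiv_mul, map_add, map_mul, map_mul, linSubst_X, pderiv_X, Finset.sum_mul]
      simp only [mul_assoc]
      congr 1
      by_cases hij : i = j
      · subst hij
        simp
      · simp [hij, Ne.symm hij]
    rw [symTrace_succ_X_mul]
    simp only [h1]
    unfold symTrace
    simp only [coeff_add, Finset.sum_add_distrib, coeff_sum, coeff_C_mul, Finset.mul_sum]
    congr 1
    · split_ifs <;> simp
    · rw [Finset.sum_comm]
  unfold eulerTrace
  simp only [h, mul_add, Finset.sum_add_distrib]
  congr 1
  · simp [Matrix.trace, Finset.sum_mul]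
  · refine Finset.sum_congr rfl fun i _ => ?_
    simp only [Finset.mul_sum, Matrix.mul_apply, Finset.sum_mul]
    rw [Finset.sum_comm]
    simp only [mul_assoc]

theorem eulerTrace_eq_sum (M : Matrix σ σ ℂ) (k : ℕ) (B : Matrix σ σ ℂ) :
    eulerTrace M k B =
      ∑ m ∈ Finset.range k, (B * M ^ m).trace * symTrace (k - 1 - m) (linSubst M) := by
  induction k generalizing B with
  | zero => simp [eulerTrace_zero]
  | succ k ih =>
    rw [eulerTrace_succ, ih, Finset.sum_range_succ', pow_zero, mul_one, add_comm]
    congr 1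
    refine Finset.sum_congr rfl fun m _ => ?_
    rw [pow_succ', Matrix.mul_assoc]
    congr 2
    omega

theorem isNewton_symTrace (M : Matrix σ σ ℂ) :
    IsNewton (fun k => (M ^ k).trace) (PowerSeries.mk fun k => symTrace k (linSubst M)) := by
  rw [isNewton_iff]
  constructor
  · simp [symTrace]
  · intro k
    simp only [PowerSeries.coeff_mk]
    have h := symTrace_eq_eulerTrace M (k + 1)
    rw [eulerTrace_eq_sum] at h
    push_cast at h
    rw [h]
    refine Finset.sum_congr rfl fun m _ => ?_
    rw [pow_succ']

end SymmetricPowerTrace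

section HMat

open scoped Kronecker

variable {N : ℕ}

theorem kronecker_pow (Z W : Matrix (Fin N) (Fin N) ℂ) (m : ℕ) :
    (Z ⊗ₖ W) ^ m = (Z ^ m) ⊗ₖ (W ^ m) := by
  induction m with
  | zero => simp
  | succ m ih => rw [pow_succ, ih, ← mul_kronecker_mul, ← pow_succ, ← pow_succ]

/-- Cauchy's identity for a diagonal matrix, as a trace on homogeneous polynomials in the
matrix entries. -/
theorem symTrace_kronecker_diagonal (d : Fin N → ℂ) (U : Matrix (Fin N) (Fin N) ℂ) (n : ℕ) :
    symTrace n (linSubst (diagonal d ⊗ₖ Uᵀ)) =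
      ∑ a ∈ Finset.finsuppAntidiag (Finset.univ : Finset (Fin N)) n,
        (∏ i, hMat U (a i)) * ∏ i, d i ^ a i := by
  have h1 := isNewton_symTrace (diagonal d ⊗ₖ Uᵀ)
  have h2 := isNewton_prod Finset.univ _ _ fun i => (isNewton_hSeries U).rescale (d i)
  have h3 : ∀ k, ((diagonal d ⊗ₖ Uᵀ) ^ k).trace = ∑ i, d i ^ k * (U ^ k).trace := by
    intro k
    rw [kronecker_pow, trace_kronecker, diagonal_pow, trace_diagonal, ← transpose_pow,
      trace_transpose, Finset.sum_mul]
    rfl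
  simp only [h3] at h1
  have h := congrArg (PowerSeries.coeff n) (h1.unique h2)
  rw [PowerSeries.coeff_mk, PowerSeries.coeff_prod] at h
  rw [h]
  refine Finset.sum_congr rfl fun a _ => ?_
  rw [← Finset.prod_mul_distrib]
  refine Finset.prod_congr rfl fun i _ => ?_
  rw [PowerSeries.coeff_rescale, hSeries, PowerSeries.coeff_mk, mul_comm]

theorem trace_mul_pow_comm (X Y : Matrix (Fin N) (Fin N) ℂ) (m : ℕ) :
    ((X * Y) ^ (m + 1)).trace = ((Y * X) ^ (m + 1)).trace := by
  have h : (X * Y) ^ (m + 1) = X * ((Y * X) ^ m * Y) := by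
    induction m with
    | zero => simp
    | succ m ih =>
      rw [pow_succ, ih, pow_succ]
      simp only [Matrix.mul_assoc]
  rw [h, trace_mul_comm, Matrix.mul_assoc, ← pow_succ]

theorem hMat_mul_comm (X Y : Matrix (Fin N) (Fin N) ℂ) (k : ℕ) :
    hMat (X * Y) k = hMat (Y * X) k := by
  induction k using Nat.strong_induction_on with
  | _ k ih =>
    rcases k with _ | k
    · simp only [hMat_zero]
    · rw [hMat_succ, hMat_succ]
      congr 1
      refine Finset.sum_congr rfl fun m _ => ?_
      rw [trace_mul_pow_comm, ih (k - m) (by omega)]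

theorem hMat_smul (c : ℂ) (X : Matrix (Fin N) (Fin N) ℂ) (k : ℕ) :
    hMat (c • X) k = c ^ k * hMat X k := by
  induction k using Nat.strong_induction_on with
  | _ k ih =>
    rcases k with _ | k
    · simp only [hMat_zero, pow_zero, mul_one]
    · rw [hMat_succ, hMat_succ, mul_left_comm (c ^ (k + 1)),
        Finset.mul_sum (a := c ^ (k + 1))]
      congr 1
      apply Finset.sum_congr rfl
      intro m hm
      have h : k + 1 = (m + 1) + (k - m) := by
        have := Finset.mem_range.1 hm
        omega
      rw [ih (k - m) (by omega), smul_pow, Matrix.trace_smul, smul_eq_mul]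
      conv_rhs => rw [h, pow_add]
      ring

theorem hMat_conjTranspose (X : Matrix (Fin N) (Fin N) ℂ) (k : ℕ) :
    hMat Xᴴ k = (starRingEnd ℂ) (hMat X k) := by
  induction k using Nat.strong_induction_on with
  | _ k ih =>
    rcases k with _ | k
    · simp only [hMat_zero, map_one]
    · rw [hMat_succ, hMat_succ, map_mul, map_inv₀, map_add, map_natCast, map_one, map_sum]
      congr 1
      refine Finset.sum_congr rfl fun m _ => ?_
      rw [ih (k - m) (by omega), map_mul, ← conjTranspose_pow, trace_conjTranspose]
      rfl

theorem hMat_mem_polyFun (k : ℕ) :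
    (fun X : Matrix (Fin N) (Fin N) ℂ => hMat X k) ∈ polyFun N := by
  have hpow : ∀ m i j, (fun X : Matrix (Fin N) (Fin N) ℂ => (X ^ m) i j) ∈ polyFun N := by
    intro m
    induction m with
    | zero =>
      intro i j
      simpa only [pow_zero] using const_mem_polyFun _
    | succ m ih =>
      intro i j
      simp only [pow_succ, Matrix.mul_apply]
      exact sum_mem_polyFun _ fun r _ => (polyFun N).mul_mem (ih i r) (entry_mem_polyFun r j)
  induction k using Nat.strong_induction_on with
  | _ k ih =>
    rcases k with _ | k
    · simp only [hMat_zero]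
      exact const_mem_polyFun 1
    · simp only [hMat_succ]
      refine (polyFun N).mul_mem (const_mem_polyFun _) (sum_mem_polyFun _ fun m _ => ?_)
      refine (polyFun N).mul_mem ?_ (ih (k - m) (by omega))
      exact sum_mem_polyFun _ fun i _ => hpow (m + 1) i i

theorem schur_mul_comm (l : Fin N → ℕ) (X Y : Matrix (Fin N) (Fin N) ℂ) :
    schur l (X * Y) = schur l (Y * X) := by
  simp only [schur, hMatZ, hMat_mul_comm X Y]

theorem schur_mem_polyFun (l : Fin N → ℕ) : schur l ∈ polyFun N := by
  refine det_mem_polyFun fun i j => ?_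
  simp only [of_apply, hMatZ]
  split_ifs
  · exact const_mem_polyFun 0
  · exact hMat_mem_polyFun _

theorem schur_conjTranspose (l : Fin N → ℕ) (X : Matrix (Fin N) (Fin N) ℂ) :
    schur l Xᴴ = (starRingEnd ℂ) (schur l X) := by
  unfold schur
  rw [RingHom.map_det]
  congr 1
  ext i j
  simp only [of_apply, hMatZ, hMat_conjTranspose, RingHom.mapMatrix_apply, map_apply]
  split_ifs <;> simp

theorem hMatZ_smul (c : ℂ) (X : Matrix (Fin N) (Fin N) ℂ) (k : ℤ) :
    hMatZ (c • X) k = c ^ k * hMatZ X k := by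
  unfold hMatZ
  split_ifs with hk
  · simp
  · lift k to ℕ using not_lt.1 hk
    simp [hMat_smul]

theorem schur_homog (l : Fin N → ℕ) : IsHomogOfDegree (schur l) (∑ i, l i) := by
  have hne : ∀ c : ℂ, c ≠ 0 → ∀ X : Matrix (Fin N) (Fin N) ℂ,
      schur l (c • X) = c ^ (∑ i, l i) * schur l X := by
    intro c hc X
    have h : (of fun i j : Fin N => hMatZ (c • X) ((l i : ℤ) - i + j)) =
        of fun i j : Fin N => c ^ (l i - i : ℤ) *
          (of fun i j : Fin N => c ^ (j : ℤ) * (of fun i j : Fin N =>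
            hMatZ X ((l i : ℤ) - i + j)) i j) i j := by
      ext i j
      simp only [of_apply]
      rw [hMatZ_smul, zpow_add₀ hc, mul_assoc]
    unfold schur
    rw [h, det_mul_column, det_mul_row, ← mul_assoc, ← Finset.prod_mul_distrib]
    congr 1
    rw [← Finset.prod_pow_eq_pow_sum]
    refine Finset.prod_congr rfl fun i _ => ?_
    rw [← zpow_add₀ hc, sub_add_cancel, zpow_natCast]
  intro c X
  have hcont := continuous_of_mem_polyFun (schur_mem_polyFun l)
  have h1 : Continuous fun c : ℂ => schur l (c • X) := hcont.comp (by fun_prop)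
  have h2 : Continuous fun c : ℂ => c ^ (∑ i, l i) * schur l X := by fun_prop
  exact congrFun (Continuous.ext_on (dense_compl_singleton (0 : ℂ)) h1 h2
    fun c hc => hne c hc X) c

end HMat

section CoefficientIntegrals

open MvPolynomial
open scoped Kronecker

variable {N : ℕ} {F Q : Matrix (Fin N) (Fin N) ℂ → ℂ}

theorem exists_eq_sum_mul_eval (hF : F ∈ polyFun N) {m m' : SUN N → Matrix (Fin N) (Fin N) ℂ}
    (hm : Continuous m) (hm' : Continuous m') {τ : Type*} {M : (τ → ℂ) → Matrix (Fin N) (Fin N) ℂ}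
    (hM : ∀ i j, ∃ p : MvPolynomial τ ℂ, ∀ x, M x i j = eval x p) :
    ∃ (ι : Type) (_ : Fintype ι) (β : ι → SUN N → ℂ) (P : ι → MvPolynomial τ ℂ),
      (∀ i, Continuous (β i)) ∧ ∀ V y, F (m V * M y * m' V) = ∑ i, β i V * eval y (P i) := by
  obtain ⟨ι, _, a, b, ha, hb, h⟩ := exists_comul hF
  have h1 := fun i => exists_comul (ha i)
  choose κ hκ c d hc hd h2 using h1
  have h3 := fun i j => exists_eval_of_mem_polyFun (hd i j) hM
  choose P hP using h3
  refine ⟨(i : ι) × κ i, inferInstance, fun s V => c s.1 s.2 (m V) * b s.1 (m' V),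
    fun s => P s.1 s.2, fun s => ?_, fun V y => ?_⟩
  · exact ((continuous_of_mem_polyFun (hc s.1 s.2)).comp hm).mul
      ((continuous_of_mem_polyFun (hb s.1)).comp hm')
  · rw [h, Fintype.sum_sigma]
    refine Finset.sum_congr rfl fun i _ => ?_
    rw [h2, Finset.sum_mul]
    refine Finset.sum_congr rfl fun j _ => ?_
    rw [hP]
    ring

theorem continuous_coeff_of_eval (hF : F ∈ polyFun N)
    {m m' : SUN N → Matrix (Fin N) (Fin N) ℂ} (hm : Continuous m) (hm' : Continuous m')
    {τ : Type*} {M : (τ → ℂ) → Matrix (Fin N) (Fin N) ℂ}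
    (hM : ∀ i j, ∃ p : MvPolynomial τ ℂ, ∀ x, M x i j = eval x p)
    {G : SUN N → MvPolynomial τ ℂ} (hG : ∀ V y, eval y (G V) = F (m V * M y * m' V))
    (b : τ →₀ ℕ) : Continuous fun V => coeff b (G V) := by
  obtain ⟨ι, _, β, P, hβ, h⟩ := exists_eq_sum_mul_eval hF hm hm' hM
  have hGV : ∀ V, G V = ∑ i, C (β i V) * P i := by
    intro V
    refine MvPolynomial.funext fun y => ?_
    rw [hG, h, map_sum]
    simp
  simp only [hGV, coeff_sum, coeff_C_mul]
  exact continuous_finsetSum _ fun i _ => (hβ i).mul continuous_const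

variable (μ : Measure (SUN N)) [μ.IsHaarMeasure]

theorem exists_integral_coeff (hF : F ∈ polyFun N)
    {m m' : SUN N → Matrix (Fin N) (Fin N) ℂ} (hm : Continuous m) (hm' : Continuous m')
    {τ : Type*} {M : (τ → ℂ) → Matrix (Fin N) (Fin N) ℂ}
    (hM : ∀ i j, ∃ p : MvPolynomial τ ℂ, ∀ x, M x i j = eval x p)
    {G : SUN N → MvPolynomial τ ℂ} (hG : ∀ V y, eval y (G V) = F (m V * M y * m' V))
    {c : SUN N → ℂ} (hc : Continuous c) :
    ∃ R : MvPolynomial τ ℂ, (∀ b, coeff b R = ∫ V, coeff b (G V) * c V ∂μ) ∧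
      ∀ y, eval y R = ∫ V, F (m V * M y * m' V) * c V ∂μ := by
  obtain ⟨ι, _, β, P, hβ, h⟩ := exists_eq_sum_mul_eval hF hm hm' hM
  have hGV : ∀ V, G V = ∑ i, C (β i V) * P i := by
    intro V
    refine MvPolynomial.funext fun y => ?_
    rw [hG, h, map_sum]
    simp
  have hint : ∀ z : ι → ℂ, ∫ V, (∑ i, β i V * z i) * c V ∂μ = ∑ i, (∫ V, β i V * c V ∂μ) * z i := by
    intro z
    have h1 : ∀ V, (∑ i, β i V * z i) * c V = ∑ i, β i V * c V * z i := by
      intro V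
      rw [Finset.sum_mul]
      exact Finset.sum_congr rfl fun i _ => by ring
    simp only [h1]
    rw [integral_finsetSum]
    · simp only [integral_mul_const]
    · exact fun i _ => integrable_of_continuous_SUN μ (((hβ i).mul hc).mul continuous_const)
  refine ⟨∑ i, C (∫ V, β i V * c V ∂μ) * P i, fun b => ?_, fun y => ?_⟩
  · simp only [hGV, coeff_sum, coeff_C_mul, hint]
  · simp only [h, hint, map_sum, map_mul, eval_C]

theorem eval_eq_sum_of_homog {σ : Type*} [Fintype σ] [DecidableEq σ] {p : MvPolynomial σ ℂ} {n : ℕ}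
    (h : ∀ (c : ℂ) (y : σ → ℂ), eval (c • y) p = c ^ n * eval y p) (y : σ → ℂ) :
    eval y p = ∑ a ∈ Finset.finsuppAntidiag Finset.univ n, coeff a p * ∏ i, y i ^ a i := by
  have h1 : (∑ a ∈ p.support, monomial a ((2 : ℂ) ^ (∑ i, a i) * coeff a p)) =
      C ((2 : ℂ) ^ n) * p := by
    refine MvPolynomial.funext fun y => ?_
    rw [map_mul, eval_C, ← h, map_sum, eval_eq']
    refine Finset.sum_congr rfl fun a _ => ?_
    rw [eval_monomial, Finsupp.prod_fintype _ _ (by simp)]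
    simp only [Pi.smul_apply, smul_eq_mul, mul_pow, Finset.prod_mul_distrib,
      Finset.prod_pow_eq_pow_sum]
    ring
  have h2 : ∀ a ∈ p.support, ∑ i, a i = n := by
    intro a ha
    have h3 := congrArg (coeff a) h1
    rw [coeff_C_mul, coeff_sum] at h3
    simp only [coeff_monomial, Finset.sum_ite_eq', ha, if_true] at h3
    have h4 := mul_right_cancel₀ (mem_support_iff.1 ha) h3
    exact Nat.pow_right_injective (le_refl 2) (by exact_mod_cast h4)
  rw [eval_eq']
  refine Finset.sum_subset (fun a ha => ?_) fun a _ ha => ?_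
  · simp [Finset.mem_finsuppAntidiag, h2 a ha]
  · rw [notMem_support_iff.1 ha, zero_mul]

/-- The monomial function in the matrix entries with exponents `a`. -/
def entryMonomial (a : Fin N × Fin N →₀ ℕ) (X : Matrix (Fin N) (Fin N) ℂ) : ℂ :=
  ∏ ij : Fin N × Fin N, X ij.1 ij.2 ^ a ij

theorem entryMonomial_mem_polyFun (a : Fin N × Fin N →₀ ℕ) : entryMonomial a ∈ polyFun N :=
  prod_mem_polyFun _ fun ij _ => (polyFun N).pow_mem (entry_mem_polyFun ij.1 ij.2) _

theorem entryMonomial_homog (a : Fin N × Fin N →₀ ℕ) :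
    IsHomogOfDegree (entryMonomial a) (∑ ij, a ij) := by
  intro c X
  simp only [entryMonomial, Matrix.smul_apply, smul_eq_mul, mul_pow, Finset.prod_mul_distrib,
    Finset.prod_pow_eq_pow_sum]

theorem eval_linSubst_monomial (Z U : Matrix (Fin N) (Fin N) ℂ) (a : Fin N × Fin N →₀ ℕ)
    (y : Fin N × Fin N → ℂ) :
    eval y (linSubst (Z ⊗ₖ Uᵀ) (monomial a 1)) =
      entryMonomial a (Z * Matrix.of (fun i j => y (i, j)) * U) := by
  rw [linSubst, aeval_monomial, map_one, one_mul, Finsupp.prod_fintype _ _ (by simp), map_prod,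
    entryMonomial]
  refine Finset.prod_congr rfl fun ij _ => ?_
  rw [map_pow, map_sum, Fintype.sum_prod_type]
  congr 1
  simp only [Matrix.mul_apply, Finset.sum_mul, kroneckerMap_apply, transpose_apply, map_mul, eval_C,
    eval_X, of_apply]
  rw [Finset.sum_comm]
  exact Finset.sum_congr rfl fun i _ => Finset.sum_congr rfl fun j _ => by ring

theorem exists_eval_of_entries (i j : Fin N) : ∃ p : MvPolynomial (Fin N × Fin N) ℂ,
    ∀ x : Fin N × Fin N → ℂ, (Matrix.of fun i j => x (i, j)) i j = eval x p :=
  ⟨X (i, j), by simp⟩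

theorem integral_symTrace_mul (hN : 1 ≤ N) {n : ℕ} (hQ : Q ∈ polyFun N)
    (hQn : IsHomogOfDegree Q n) (Z : Matrix (Fin N) (Fin N) ℂ) :
    ∫ V, symTrace n (linSubst (Z ⊗ₖ (toMat V)ᵀ)) * Q (toMat V)ᴴ ∂μ =
      ∫ V, Q ((toMat V)ᴴ * Z * toMat V) ∂μ := by
  have hT := continuous_toMat (N := N)
  have hTH := continuous_conjTranspose_toMat (N := N)
  have hQc := continuous_of_mem_polyFun hQ
  have hex := fun V : SUN N => exists_eval_entries (comp_mul_left_mem_polyFun hQ ((toMat V)ᴴ * Z))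
  choose W hW using hex
  have hWy : ∀ V y, eval y (W V) =
      Q ((toMat V)ᴴ * Z * Matrix.of (fun i j => y (i, j)) * (1 : Matrix (Fin N) (Fin N) ℂ)) := by
    intro V y
    rw [Matrix.mul_one, hW]
    rfl
  have hcZ : Continuous fun V : SUN N => (toMat V)ᴴ * Z := hTH.matrix_mul continuous_const
  have hc1 : ∀ a : Fin N × Fin N →₀ ℕ, Continuous fun V : SUN N =>
      coeff a (linSubst (Z ⊗ₖ (toMat V)ᵀ) (monomial a 1)) := fun a =>
    continuous_coeff_of_eval (entryMonomial_mem_polyFun a) continuous_const hT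
      exists_eval_of_entries (fun V y => eval_linSubst_monomial Z (toMat V) a y) a
  have hc2 : ∀ a : Fin N × Fin N →₀ ℕ, Continuous fun V : SUN N => coeff a (W V) := fun a =>
    continuous_coeff_of_eval hQ hcZ continuous_const exists_eval_of_entries hWy a
  have hce : ∀ a : Fin N × Fin N →₀ ℕ, Continuous fun V : SUN N => entryMonomial a (toMat V) :=
    fun a => (continuous_of_mem_polyFun (entryMonomial_mem_polyFun a)).comp hT
  have hcQ : Continuous fun V : SUN N => Q (toMat V)ᴴ := hQc.comp hTH
  have key : ∀ a ∈ Finset.finsuppAntidiag (Finset.univ : Finset (Fin N × Fin N)) n,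
      ∫ V, coeff a (linSubst (Z ⊗ₖ (toMat V)ᵀ) (monomial a 1)) * Q (toMat V)ᴴ ∂μ =
        ∫ V, coeff a (W V) * entryMonomial a (toMat V) ∂μ := by
    intro a ha
    obtain ⟨R₁, hR₁, hR₁'⟩ := exists_integral_coeff μ (entryMonomial_mem_polyFun a)
      (continuous_const (y := Z)) hT exists_eval_of_entries
      (fun V y => eval_linSubst_monomial Z (toMat V) a y) hcQ
    obtain ⟨R₂, hR₂, hR₂'⟩ := exists_integral_coeff μ hQ hcZ continuous_const
      exists_eval_of_entries hWy (hce a)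
    have hR : R₁ = R₂ := by
      refine MvPolynomial.funext fun y => ?_
      rw [hR₁', hR₂']
      have hdeg : IsHomogOfDegree (entryMonomial a) n := by
        rw [← (Finset.mem_finsuppAntidiag.1 ha).1]
        exact entryMonomial_homog a
      have h := integral_mul_conjTranspose_mul μ hN (entryMonomial_mem_polyFun a) hQ hdeg hQn
        (Z * Matrix.of fun i j => y (i, j)) 1
      simp only [Matrix.mul_one] at h ⊢
      rw [h]
      simp only [Matrix.mul_assoc, mul_comm (entryMonomial a _)]
    rw [← hR₁, ← hR₂, hR]
  have hhom : ∀ V, Q ((toMat V)ᴴ * Z * toMat V) =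
      ∑ a ∈ Finset.finsuppAntidiag (Finset.univ : Finset (Fin N × Fin N)) n,
        coeff a (W V) * entryMonomial a (toMat V) := by
    intro V
    have hs : ∀ (c : ℂ) (y : Fin N × Fin N → ℂ), eval (c • y) (W V) = c ^ n * eval y (W V) := by
      intro c y
      rw [hWy, hWy, ← hQn, Matrix.mul_one, Matrix.mul_one, ← Matrix.mul_smul]
      rfl
    exact (hW V (toMat V)).trans (eval_eq_sum_of_homog hs fun ij => toMat V ij.1 ij.2)
  unfold symTrace
  simp only [hhom, Finset.sum_mul]
  rw [integral_finsetSum, integral_finsetSum]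
  · exact Finset.sum_congr rfl key
  · exact fun a _ => integrable_of_continuous_SUN μ ((hc2 a).mul (hce a))
  · exact fun a _ => integrable_of_continuous_SUN μ ((hc1 a).mul hcQ)

end CoefficientIntegrals

section JacobiTrudi

open MvPolynomial
open scoped Kronecker

variable {N : ℕ} {Q : Matrix (Fin N) (Fin N) ℂ → ℂ} (μ : Measure (SUN N)) [μ.IsHaarMeasure]

theorem exists_eval_of_diagonal (i j : Fin N) :
    ∃ p : MvPolynomial (Fin N) ℂ, ∀ d, diagonal d i j = eval d p := by
  by_cases h : i = j
  · exact ⟨X i, fun d => by simp [h]⟩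
  · exact ⟨0, fun d => by simp [h]⟩

theorem integral_prod_hMat_mul (hN : 1 ≤ N) {n : ℕ} (hQ : Q ∈ polyFun N)
    (hQn : IsHomogOfDegree Q n) {q : SUN N → MvPolynomial (Fin N) ℂ}
    (hq : ∀ V d, eval d (q V) = Q ((toMat V)ᴴ * diagonal d * toMat V)) (a : Fin N →₀ ℕ)
    (ha : ∑ i, a i = n) :
    ∫ V, (∏ i, hMat (toMat V) (a i)) * Q (toMat V)ᴴ ∂μ = ∫ V, coeff a (q V) ∂μ := by
  have hT := continuous_toMat (N := N)
  have hTH := continuous_conjTranspose_toMat (N := N)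
  obtain ⟨R, hR, hR'⟩ := exists_integral_coeff μ hQ hTH hT exists_eval_of_diagonal hq
    (continuous_const (y := (1 : ℂ)))
  have hRe : R = ∑ b ∈ Finset.finsuppAntidiag (Finset.univ : Finset (Fin N)) n,
      monomial b (∫ V, (∏ i, hMat (toMat V) (b i)) * Q (toMat V)ᴴ ∂μ) := by
    refine MvPolynomial.funext fun d => ?_
    rw [hR']
    simp only [mul_one]
    rw [← integral_symTrace_mul μ hN hQ hQn]
    simp only [symTrace_kronecker_diagonal, Finset.sum_mul]
    rw [integral_finsetSum, map_sum]
    · refine Finset.sum_congr rfl fun b _ => ?_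
      rw [eval_monomial, Finsupp.prod_fintype _ _ (by simp), ← integral_mul_const]
      exact integral_congr_ae (Filter.Eventually.of_forall fun V => by ring)
    · intro b _
      refine integrable_of_continuous_SUN μ (((Continuous.mul ?_ continuous_const)).mul
        ((continuous_of_mem_polyFun hQ).comp hTH))
      exact continuous_finsetProd _ fun i _ =>
        (continuous_of_mem_polyFun (hMat_mem_polyFun (b i))).comp hT
  have hc := hR a
  simp only [mul_one] at hc
  rw [← hc, hRe, coeff_sum]
  simp [coeff_monomial, Finset.mem_finsuppAntidiag, ha]

/-- The Vandermonde determinant in the form `det (X_i ^ (N - 1 - j))`. -/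
def vdmPoly (N : ℕ) : MvPolynomial (Fin N) ℂ :=
  (Matrix.of fun i j : Fin N => (X i : MvPolynomial (Fin N) ℂ) ^ (N - 1 - (j : ℕ))).det

/-- The exponent `λ + ρ` with `ρ = (N - 1, …, 1, 0)`. -/
def shiftedExp (l : Fin N → ℕ) : Fin N →₀ ℕ :=
  Finsupp.equivFunOnFinite.symm fun i => l i + (N - 1 - (i : ℕ))

theorem coeff_vdmPoly_mul (l : Fin N → ℕ) (q : MvPolynomial (Fin N) ℂ) :
    coeff (shiftedExp l) (vdmPoly N * q) = ∑ w : Equiv.Perm (Fin N), (Equiv.Perm.sign w : ℂ) *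
      if ∀ i, N - 1 - (w i : ℕ) ≤ l i + (N - 1 - (i : ℕ)) then
        coeff (Finsupp.equivFunOnFinite.symm fun i =>
          l i + (N - 1 - (i : ℕ)) - (N - 1 - (w i : ℕ))) q else 0 := by
  rw [vdmPoly, ← det_transpose, det_apply', Finset.sum_mul, coeff_sum]
  refine Finset.sum_congr rfl fun w _ => ?_
  have h : ∏ i, (X i : MvPolynomial (Fin N) ℂ) ^ (N - 1 - (w i : ℕ)) =
      monomial (Finsupp.equivFunOnFinite.symm fun i => N - 1 - (w i : ℕ)) 1 := by
    rw [monomial_eq, C_1, one_mul, Finsupp.prod_fintype _ _ (by simp)]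
    rfl
  have hsgn : (((Equiv.Perm.sign w : ℤˣ) : ℤ) : MvPolynomial (Fin N) ℂ) =
      C ((Equiv.Perm.sign w : ℤˣ) : ℂ) := by
    simp
  simp only [transpose_apply, of_apply]
  rw [h, hsgn, mul_assoc, coeff_C_mul, coeff_monomial_mul', one_mul]
  congr 1
  have hsub : shiftedExp l - Finsupp.equivFunOnFinite.symm (fun i => N - 1 - (w i : ℕ)) =
      Finsupp.equivFunOnFinite.symm fun i => l i + (N - 1 - (i : ℕ)) - (N - 1 - (w i : ℕ)) := by
    ext i
    rfl
  rw [hsub]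
  exact if_congr Iff.rfl rfl rfl

theorem integral_schur_mul (hN : 1 ≤ N) {l : Fin N → ℕ} (hQ : Q ∈ polyFun N)
    (hQn : IsHomogOfDegree Q (∑ i, l i)) {q : SUN N → MvPolynomial (Fin N) ℂ}
    (hq : ∀ V d, eval d (q V) = Q ((toMat V)ᴴ * diagonal d * toMat V)) :
    ∫ V, schur l (toMat V) * Q (toMat V)ᴴ ∂μ =
      ∫ V, coeff (shiftedExp l) (vdmPoly N * q V) ∂μ := by
  have hT := continuous_toMat (N := N)
  have hTH := continuous_conjTranspose_toMat (N := N)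
  have hh : ∀ k : ℤ, Continuous fun V : SUN N => hMatZ (toMat V) k := by
    intro k
    unfold hMatZ
    split_ifs
    · exact continuous_const
    · exact (continuous_of_mem_polyFun (hMat_mem_polyFun _)).comp hT
  have hcoeff := continuous_coeff_of_eval hQ hTH hT exists_eval_of_diagonal hq
  have hs : ∀ V : SUN N, schur l (toMat V) * Q (toMat V)ᴴ =
      ∑ w : Equiv.Perm (Fin N), (Equiv.Perm.sign w : ℂ) *
        ((∏ i, hMatZ (toMat V) ((l i : ℤ) - (i : ℤ) + (w i : ℤ))) * Q (toMat V)ᴴ) := by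
    intro V
    rw [schur, ← det_transpose, det_apply', Finset.sum_mul]
    refine Finset.sum_congr rfl fun w _ => ?_
    simp only [transpose_apply, of_apply]
    rw [mul_assoc]
  simp only [hs, coeff_vdmPoly_mul]
  rw [integral_finsetSum, integral_finsetSum]
  · refine Finset.sum_congr rfl fun w _ => ?_
    rw [integral_const_mul, integral_const_mul]
    congr 1
    split_ifs with hw
    · rw [← integral_prod_hMat_mul μ hN hQ hQn hq]
      · refine integral_congr_ae (Filter.Eventually.of_forall fun V => ?_)
        simp only
        congr 1
        refine Finset.prod_congr rfl fun i _ => ?_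
        have h1 := hw i
        have h2 := i.isLt
        have h3 := (w i).isLt
        have h4 : (l i : ℤ) - (i : ℤ) + (w i : ℤ) =
            ((l i + (N - 1 - (i : ℕ)) - (N - 1 - (w i : ℕ)) : ℕ) : ℤ) := by
          omega
        rw [h4, hMatZ, if_neg (by omega), Int.toNat_natCast]
        rfl
      · have h5 : (∑ i, (l i + (N - 1 - (i : ℕ)) - (N - 1 - (w i : ℕ)))) +
            ∑ i, (N - 1 - (w i : ℕ)) = ∑ i, l i + ∑ i : Fin N, (N - 1 - (i : ℕ)) := by
          rw [← Finset.sum_add_distrib, ← Finset.sum_add_distrib]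
          exact Finset.sum_congr rfl fun i _ => Nat.sub_add_cancel (hw i)
        rw [Equiv.sum_comp w fun j : Fin N => N - 1 - (j : ℕ)] at h5
        exact Nat.add_right_cancel h5
    · obtain ⟨i, hi⟩ := not_forall.1 hw
      have h0 : ∀ V : SUN N,
          (∏ i, hMatZ (toMat V) ((l i : ℤ) - (i : ℤ) + (w i : ℤ))) * Q (toMat V)ᴴ = 0 := by
        intro V
        have h2 := i.isLt
        have h3 := (w i).isLt
        rw [Finset.prod_eq_zero (Finset.mem_univ i), zero_mul]
        rw [hMatZ, if_pos (by omega)]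
      simp only [h0]
  · intro w _
    refine integrable_of_continuous_SUN μ (continuous_const.mul ?_)
    split_ifs
    · exact hcoeff _
    · exact continuous_const
  · intro w _
    exact integrable_of_continuous_SUN μ (continuous_const.mul
      ((continuous_finsetProd _ fun i _ => hh _).mul ((continuous_of_mem_polyFun hQ).comp hTH)))

end JacobiTrudi

section Bialternant

variable {N : ℕ}

theorem coeff_polynomial_mul (P : Polynomial ℂ) (hP : P.natDegree < N) (F : PowerSeries ℂ) (n : ℕ) :
    PowerSeries.coeff n ((P : PowerSeries ℂ) * F) =
      ∑ j : Fin N, (if N - 1 - (j : ℕ) ≤ n then PowerSeries.coeff (n - (N - 1 - j)) F else 0) *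
        P.coeff (N - 1 - j) := by
  rw [← Finset.sum_range (fun j => (if N - 1 - j ≤ n then
      PowerSeries.coeff (n - (N - 1 - j)) F else 0) * P.coeff (N - 1 - j)),
    Finset.sum_range_reflect (fun b => (if b ≤ n then
      PowerSeries.coeff (n - b) F else 0) * P.coeff b)]
  conv_lhs => rw [P.as_sum_range' N hP]
  rw [← Polynomial.coeToPowerSeries.ringHom_apply, map_sum, Finset.sum_mul, map_sum]
  refine Finset.sum_congr rfl fun b _ => ?_
  rw [Polynomial.coeToPowerSeries.ringHom_apply, ← Polynomial.C_mul_X_pow_eq_monomial,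
    Polynomial.coe_mul, Polynomial.coe_C, Polynomial.coe_pow, Polynomial.coe_X, mul_assoc,
    PowerSeries.coeff_C_mul, PowerSeries.coeff_X_pow_mul', mul_comm]

/-- The polynomial `∏_{l ≠ k} (1 - d_l t)`. -/
def coprodPoly (d : Fin N → ℂ) (k : Fin N) : Polynomial ℂ :=
  ∏ l ∈ Finset.univ.erase k, (1 - Polynomial.C (d l) * Polynomial.X)

theorem natDegree_coprodPoly_lt (d : Fin N → ℂ) (k : Fin N) : (coprodPoly d k).natDegree < N := by
  have h : (coprodPoly d k).natDegree ≤ ∑ l ∈ Finset.univ.erase k, 1 := by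
    refine (Polynomial.natDegree_prod_le _ _).trans (Finset.sum_le_sum fun l _ => ?_)
    compute_degree
  rw [Finset.sum_const, Finset.card_erase_of_mem (Finset.mem_univ k), Finset.card_univ,
    Fintype.card_fin, smul_eq_mul, mul_one] at h
  have := k.isLt
  omega

theorem rescale_mk_one_mul (d : ℂ) :
    (1 - PowerSeries.C d * PowerSeries.X) * PowerSeries.rescale d (PowerSeries.mk 1) = 1 := by
  have h := congrArg (PowerSeries.rescale d) (PowerSeries.mk_one_mul_one_sub_eq_one ℂ)
  rw [map_mul, map_sub, map_one, PowerSeries.rescale_X, mul_comm] at h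
  exact h

theorem coprodPoly_mul_hSeries (d : Fin N → ℂ) (k : Fin N) :
    (coprodPoly d k : PowerSeries ℂ) * hSeries (diagonal d) =
      PowerSeries.rescale (d k) (PowerSeries.mk 1) := by
  rw [hSeries_diagonal, ← Finset.mul_prod_erase _ _ (Finset.mem_univ k), mul_left_comm, coprodPoly,
    ← Polynomial.coeToPowerSeries.ringHom_apply, map_prod, ← Finset.prod_mul_distrib]
  rw [Finset.prod_eq_one, mul_one]
  intro l _
  rw [Polynomial.coeToPowerSeries.ringHom_apply]
  simpa using rescale_mk_one_mul (d l)

theorem jacobiTrudi_mul_coprodPoly (l : Fin N → ℕ) (d : Fin N → ℂ) :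
    (Matrix.of fun i j : Fin N => hMatZ (diagonal d) ((l i : ℤ) - (i : ℤ) + (j : ℤ))) *
      (Matrix.of fun j k : Fin N => (coprodPoly d k).coeff (N - 1 - j)) =
    Matrix.of fun i k : Fin N => d k ^ (l i + (N - 1 - (i : ℕ))) := by
  ext i k
  have h := congrArg (PowerSeries.coeff (l i + (N - 1 - (i : ℕ)))) (coprodPoly_mul_hSeries d k)
  rw [coeff_polynomial_mul _ (natDegree_coprodPoly_lt d k), PowerSeries.coeff_rescale] at h
  simp only [PowerSeries.coeff_mk, Pi.one_apply, mul_one] at h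
  rw [Matrix.mul_apply]
  simp only [of_apply]
  rw [← h]
  refine Finset.sum_congr rfl fun j _ => ?_
  congr 1
  have h2 := i.isLt
  have h3 := j.isLt
  rw [hMatZ]
  split_ifs with h4 h5 h5
  · omega
  · rfl
  · rw [hSeries, PowerSeries.coeff_mk]
    congr 1
    omega
  · omega

theorem schur_zero (X : Matrix (Fin N) (Fin N) ℂ) : schur 0 X = 1 := by
  rw [schur, det_of_isUpperTriangular]
  · refine Finset.prod_eq_one fun i _ => ?_
    simp [hMatZ, hMat_zero]
  · intro i j hij
    have h : (j : ℕ) < i := hij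
    simp only [of_apply, Pi.zero_apply, hMatZ]
    rw [if_pos (by omega)]

/-- Jacobi's bialternant formula. -/
theorem schur_diagonal_mul (l : Fin N → ℕ) (d : Fin N → ℂ) :
    schur l (diagonal d) * (Matrix.of fun i k : Fin N => d k ^ (N - 1 - (i : ℕ))).det =
      (Matrix.of fun i k : Fin N => d k ^ (l i + (N - 1 - (i : ℕ)))).det := by
  have h0 := congrArg det (jacobiTrudi_mul_coprodPoly 0 d)
  have h1 := congrArg det (jacobiTrudi_mul_coprodPoly l d)
  rw [det_mul, ← schur] at h0 h1
  rw [schur_zero, one_mul] at h0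
  simp only [Pi.zero_apply, zero_add] at h0
  rw [← h0, h1]

open MvPolynomial

theorem eval_vdmPoly (d : Fin N → ℂ) :
    eval d (vdmPoly N) = (Matrix.of fun i k : Fin N => d k ^ (N - 1 - (i : ℕ))).det := by
  rw [vdmPoly, RingHom.map_det, ← det_transpose]
  congr 1
  ext i j
  simp

theorem shifted_injective {l : Fin N → ℕ} (hl : Antitone l) :
    Function.Injective fun i : Fin N => l i + (N - 1 - (i : ℕ)) := by
  have h : StrictAnti fun i : Fin N => l i + (N - 1 - (i : ℕ)) := by
    intro i j hij
    have h1 := hl hij.le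
    have h2 : (i : ℕ) < j := hij
    have h3 := j.isLt
    simp only
    omega
  exact h.injective

theorem coeff_vdmPoly_mul_schur {l : Fin N → ℕ} (hl : Antitone l) {q : MvPolynomial (Fin N) ℂ}
    (hq : ∀ d, eval d q = schur l (diagonal d)) : coeff (shiftedExp l) (vdmPoly N * q) = 1 := by
  have h : vdmPoly N * q =
      (Matrix.of fun i k : Fin N =>
        (X k : MvPolynomial (Fin N) ℂ) ^ (l i + (N - 1 - (i : ℕ)))).det := by
    refine MvPolynomial.funext fun d => ?_
    rw [map_mul, eval_vdmPoly, hq, mul_comm, schur_diagonal_mul, RingHom.map_det]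
    congr 1
    ext i j
    simp
  have hmon : ∀ w : Equiv.Perm (Fin N),
      ∏ i, (X i : MvPolynomial (Fin N) ℂ) ^ (l (w i) + (N - 1 - (w i : ℕ))) =
        monomial (Finsupp.equivFunOnFinite.symm fun i => l (w i) + (N - 1 - (w i : ℕ))) 1 := by
    intro w
    rw [monomial_eq, C_1, one_mul, Finsupp.prod_fintype _ _ (by simp)]
    rfl
  have hsgn : ∀ w : Equiv.Perm (Fin N),
      (((Equiv.Perm.sign w : ℤˣ) : ℤ) : MvPolynomial (Fin N) ℂ) =
        C ((Equiv.Perm.sign w : ℤˣ) : ℂ) := by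
    simp
  rw [h, det_apply', coeff_sum]
  simp only [of_apply, hmon, hsgn, coeff_C_mul, coeff_monomial]
  rw [Finset.sum_eq_single 1]
  · simp [shiftedExp]
  · intro w _ hw
    rw [if_neg, mul_zero]
    intro he
    apply hw
    ext i
    have := DFunLike.congr_fun he i
    exact congrArg Fin.val (shifted_injective hl this)
  · simp

theorem integral_schur_mul_schur (μ : Measure (SUN N)) [μ.IsHaarMeasure] [IsProbabilityMeasure μ]
    (hN : 1 ≤ N) {l : Fin N → ℕ} (hl : Antitone l) :
    ∫ V, schur l (toMat V) * schur l (toMat V)ᴴ ∂μ = 1 := by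
  obtain ⟨q, hq⟩ := exists_eval_of_mem_polyFun (schur_mem_polyFun l)
    (M := fun d : Fin N → ℂ => diagonal d) exists_eval_of_diagonal
  have hqV : ∀ (V : SUN N) d, eval d q = schur l ((toMat V)ᴴ * diagonal d * toMat V) := by
    intro V d
    rw [schur_mul_comm, ← Matrix.mul_assoc, toMat_mul_conjTranspose, Matrix.one_mul, hq]
  rw [integral_schur_mul μ hN (schur_mem_polyFun l) (schur_homog l) (q := fun _ => q) hqV]
  simp [coeff_vdmPoly_mul_schur hl fun d => (hq d).symm]

end Bialternant

section LexTop

open MvPolynomial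
open scoped MonomialOrder

variable {N : ℕ}

/-- All monomials of `p` are lexicographically at most `a`, and the coefficient at `a` is `c`. -/
def HasLexTop (p : MvPolynomial (Fin N) ℂ) (a : Fin N →₀ ℕ) (c : ℂ) : Prop :=
  MonomialOrder.lex.degree p ≼[MonomialOrder.lex] a ∧ coeff a p = c

theorem HasLexTop.of_coeff {p : MvPolynomial (Fin N) ℂ} {a : Fin N →₀ ℕ}
    (h : ∀ b, coeff b p ≠ 0 → toLex b ≤ toLex a) : HasLexTop p a (coeff a p) :=
  ⟨MonomialOrder.degree_le_iff.2 fun b hb => h b (mem_support_iff.1 hb), rfl⟩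

theorem HasLexTop.mul {p q : MvPolynomial (Fin N) ℂ} {a b : Fin N →₀ ℕ} {c d : ℂ}
    (hp : HasLexTop p a c) (hq : HasLexTop q b d) : HasLexTop (p * q) (a + b) (c * d) := by
  refine ⟨MonomialOrder.degree_mul_le.trans ?_, ?_⟩
  · rw [map_add, map_add]
    exact add_le_add hp.1 hq.1
  · rw [MonomialOrder.coeff_mul_of_add_of_degree_le hp.1 hq.1, hp.2, hq.2]

theorem hasLexTop_one : HasLexTop (1 : MvPolynomial (Fin N) ℂ) 0 1 := by
  refine ⟨?_, by simp⟩
  simp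

theorem HasLexTop.pow {p : MvPolynomial (Fin N) ℂ} {a : Fin N →₀ ℕ} {c : ℂ}
    (hp : HasLexTop p a c) (n : ℕ) : HasLexTop (p ^ n) (n • a) (c ^ n) := by
  induction n with
  | zero => simpa using hasLexTop_one
  | succ n ih =>
    rw [pow_succ, pow_succ, succ_nsmul]
    exact ih.mul hp

theorem hasLexTop_prod {ι : Type*} (s : Finset ι) {p : ι → MvPolynomial (Fin N) ℂ}
    {a : ι → Fin N →₀ ℕ} {c : ι → ℂ} (h : ∀ i, HasLexTop (p i) (a i) (c i)) :
    HasLexTop (∏ i ∈ s, p i) (∑ i ∈ s, a i) (∏ i ∈ s, c i) := by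
  induction s using Finset.induction_on with
  | empty => simpa using hasLexTop_one
  | insert j s hj ih =>
    rw [Finset.prod_insert hj, Finset.prod_insert hj, Finset.sum_insert hj]
    exact (h j).mul ih

/-- The indicator of the initial segment `{0, …, k}`. -/
def initialExp (k : Fin N) : Fin N →₀ ℕ :=
  Finsupp.equivFunOnFinite.symm fun i => if i ≤ k then 1 else 0

/-- The exponent of the monomial `∏ᵢ x_{f i}`. -/
def choiceExp {k : Fin N} (f : {i : Fin N // i ≤ k} → Fin N) : Fin N →₀ ℕ :=
  ∑ i, Finsupp.single (f i) 1

theorem initialExp_apply (k i : Fin N) : initialExp k i = if i ≤ k then 1 else 0 := rfl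

theorem choiceExp_apply {k : Fin N} (f : {i : Fin N // i ≤ k} → Fin N) (m : Fin N) :
    choiceExp f m = ∑ i, if f i = m then 1 else 0 := by
  simp [choiceExp, Finsupp.finsetSum_apply, Finsupp.single_apply]

theorem sum_choiceExp {k : Fin N} (f : {i : Fin N // i ≤ k} → Fin N) :
    ∑ m, choiceExp f m = ∑ m, initialExp k m := by
  simp only [choiceExp_apply, initialExp_apply]
  rw [Finset.sum_comm]
  simp [Fintype.card_subtype]

theorem choiceExp_le_one {k : Fin N} {f : {i : Fin N // i ≤ k} → Fin N}
    (hf : Function.Injective f) (m : Fin N) : choiceExp f m ≤ 1 := by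
  rw [choiceExp_apply, Finset.sum_boole, Nat.cast_id, Finset.card_le_one]
  intro a ha b hb
  simp only [Finset.mem_filter] at ha hb
  exact hf (ha.2.trans hb.2.symm)

theorem exists_lt_of_not_toLex_le {a b : Fin N →₀ ℕ} (h : ¬ toLex a ≤ toLex b) :
    ∃ i, (∀ j, j < i → b j = a j) ∧ b i < a i :=
  Finsupp.lex_def.1 (not_le.1 h)

theorem toLex_choiceExp_le {k : Fin N} {f : {i : Fin N // i ≤ k} → Fin N}
    (hf : Function.Injective f) : toLex (choiceExp f) ≤ toLex (initialExp k) := by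
  by_contra hlt
  obtain ⟨i, hj, hi⟩ := exists_lt_of_not_toLex_le hlt
  have h1 := choiceExp_le_one hf i
  have hki : k < i := by
    by_contra hik
    rw [initialExp_apply, if_pos (not_lt.1 hik)] at hi
    omega
  have h2 : ∑ m, initialExp k m < ∑ m, choiceExp f m := by
    refine Finset.sum_lt_sum (fun m _ => ?_) ⟨i, Finset.mem_univ i, hi⟩
    rcases lt_or_ge m i with hm | hm
    · exact (hj m hm).le
    · rw [initialExp_apply, if_neg (not_le.2 (hki.trans_le hm))]
      exact Nat.zero_le _
  rw [sum_choiceExp] at h2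
  exact lt_irrefl _ h2

theorem choiceExp_eq_iff {k : Fin N} {f : {i : Fin N // i ≤ k} → Fin N}
    (hf : Function.Injective f) : choiceExp f = initialExp k ↔ ∀ i, f i ≤ k := by
  constructor
  · intro h i
    by_contra hi
    have h1 := DFunLike.congr_fun h (f i)
    rw [initialExp_apply, if_neg hi, choiceExp_apply] at h1
    have h2 := Finset.sum_eq_zero_iff.1 h1 i (Finset.mem_univ i)
    simp at h2
  · intro h
    have hle : ∀ m ∈ Finset.univ, choiceExp f m ≤ initialExp k m := by
      intro m _
      rw [initialExp_apply]
      split_ifs with hm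
      · exact choiceExp_le_one hf m
      · rw [choiceExp_apply]
        refine (Finset.sum_eq_zero fun i _ => if_neg ?_).le
        rintro rfl
        exact hm (h i)
    ext m
    exact (Finset.sum_eq_sum_iff_of_le hle).1 (sum_choiceExp f) m (Finset.mem_univ m)

/-- The coefficient of `∏ᵢ x_{f i}` in the expansion of the leading minor of `A diag(x) B`. -/
def minorCoeff (A B : Matrix (Fin N) (Fin N) ℂ) {k : Fin N}
    (f : {i : Fin N // i ≤ k} → Fin N) : ℂ :=
  (∏ i, B (f i) i) * (Matrix.of fun i j : {i : Fin N // i ≤ k} => A j (f i)).det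

theorem leadMinor_mul_diagonal_mul (k : Fin N) (A B : Matrix (Fin N) (Fin N) ℂ) (d : Fin N → ℂ) :
    leadMinor k (A * diagonal d * B) =
      ∑ f : {i : Fin N // i ≤ k} → Fin N, minorCoeff A B f * ∏ i, d (f i) := by
  have h : ((A * diagonal d * B).toSquareBlockProp (· ≤ k))ᵀ =
      of fun i : {i : Fin N // i ≤ k} =>
        ∑ m : Fin N, (d m * B m i) • fun j : {i : Fin N // i ≤ k} => A j m := by
    ext i j
    change (A * diagonal d * B) j i = _
    simp only [of_apply, Matrix.mul_apply (M := A * diagonal d), mul_diagonal, Finset.sum_apply,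
      Pi.smul_apply, smul_eq_mul]
    exact Finset.sum_congr rfl fun m _ => by ring
  rw [leadMinor, ← det_transpose, h]
  have h2 := (detRowAlternating (n := {i : Fin N // i ≤ k}) (R := ℂ)).toMultilinearMap.map_sum
    (fun (i : {i : Fin N // i ≤ k}) (m : Fin N) =>
      (d m * B m i) • fun j : {i : Fin N // i ≤ k} => A j m)
  refine h2.trans (Finset.sum_congr rfl fun f _ => ?_)
  rw [MultilinearMap.map_smul_univ, smul_eq_mul, Finset.prod_mul_distrib, minorCoeff]
  change _ * det _ = _
  rw [mul_comm (∏ i, d (f i)), mul_assoc, mul_assoc, mul_comm (det _)]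
  rfl

theorem minorCoeff_eq_zero (A B : Matrix (Fin N) (Fin N) ℂ) {k : Fin N}
    {f : {i : Fin N // i ≤ k} → Fin N} (hf : ¬ Function.Injective f) : minorCoeff A B f = 0 := by
  obtain ⟨i, j, hij, hne⟩ := Function.not_injective_iff.1 hf
  rw [minorCoeff, det_zero_of_row_eq hne, mul_zero]
  ext m
  simp only [of_apply, hij]

theorem leadMinor_mul_initial_mul (k : Fin N) (A B : Matrix (Fin N) (Fin N) ℂ) :
    leadMinor k (A * diagonal (fun i => if i ≤ k then 1 else 0) * B) =
      leadMinor k A * leadMinor k B := by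
  rw [leadMinor, leadMinor, leadMinor, ← det_mul]
  congr 1
  ext i j
  change (A * diagonal (fun i => if i ≤ k then 1 else 0) * B : Matrix (Fin N) (Fin N) ℂ) i j =
    ∑ t : {t // t ≤ k}, A i t * B t j
  simp only [Matrix.mul_apply (M := A * diagonal _), mul_diagonal, mul_ite, mul_one, mul_zero,
    ite_mul, zero_mul]
  rw [← Finset.sum_filter]
  exact Finset.sum_subtype _ (by simp) fun t => A i t * B t j

/-- The leading minor of `A diag(x) B` as a polynomial in `x`. -/
def minorPoly (k : Fin N) (A B : Matrix (Fin N) (Fin N) ℂ) : MvPolynomial (Fin N) ℂ :=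
  ∑ f : {i : Fin N // i ≤ k} → Fin N, monomial (choiceExp f) (minorCoeff A B f)

theorem eval_minorPoly (k : Fin N) (A B : Matrix (Fin N) (Fin N) ℂ) (d : Fin N → ℂ) :
    eval d (minorPoly k A B) = leadMinor k (A * diagonal d * B) := by
  rw [leadMinor_mul_diagonal_mul, minorPoly, map_sum]
  refine Finset.sum_congr rfl fun f _ => ?_
  rw [eval_monomial, choiceExp, Finsupp.prod_fintype _ _ (by simp)]
  congr 1
  simp only [Finsupp.finsetSum_apply, ← Finset.prod_pow_eq_pow_sum]
  rw [Finset.prod_comm]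
  refine Finset.prod_congr rfl fun i _ => ?_
  simp [Finsupp.single_apply, pow_ite]

theorem hasLexTop_minorPoly (k : Fin N) (A B : Matrix (Fin N) (Fin N) ℂ) :
    HasLexTop (minorPoly k A B) (initialExp k) (leadMinor k A * leadMinor k B) := by
  have hc : coeff (initialExp k) (minorPoly k A B) = leadMinor k A * leadMinor k B := by
    rw [← leadMinor_mul_initial_mul, leadMinor_mul_diagonal_mul, minorPoly, coeff_sum]
    refine Finset.sum_congr rfl fun f _ => ?_
    by_cases hf : Function.Injective f
    · rw [coeff_monomial, Finset.prod_boole]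
      simp only [choiceExp_eq_iff hf, Finset.mem_univ, true_imp_iff, mul_ite, mul_one, mul_zero]
    · rw [minorCoeff_eq_zero A B hf, monomial_zero, coeff_zero, zero_mul]
  rw [← hc]
  refine HasLexTop.of_coeff fun b hb => ?_
  rw [minorPoly, coeff_sum] at hb
  obtain ⟨f, -, hf⟩ := Finset.exists_ne_zero_of_sum_ne_zero hb
  rw [coeff_monomial] at hf
  split_ifs at hf with he
  · rw [← he]
    refine toLex_choiceExp_le ?_
    by_contra hinj
    exact hf (minorCoeff_eq_zero A B hinj)
  · exact absurd rfl hf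

/-- `leadProd l (A diag(x) B)` as a polynomial in `x`. -/
def leadProdPoly (l : Fin N → ℕ) (A B : Matrix (Fin N) (Fin N) ℂ) : MvPolynomial (Fin N) ℂ :=
  ∏ k, minorPoly k A B ^ partGap l k

theorem eval_leadProdPoly (l : Fin N → ℕ) (A B : Matrix (Fin N) (Fin N) ℂ) (d : Fin N → ℂ) :
    eval d (leadProdPoly l A B) = leadProd l (A * diagonal d * B) := by
  simp only [leadProdPoly, leadProd, map_prod, map_pow, eval_minorPoly]

theorem hasLexTop_leadProdPoly {l : Fin N → ℕ} (hl : Antitone l)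
    (A B : Matrix (Fin N) (Fin N) ℂ) :
    HasLexTop (leadProdPoly l A B) (Finsupp.equivFunOnFinite.symm l)
      (leadProd l A * leadProd l B) := by
  have h := hasLexTop_prod Finset.univ fun k => (hasLexTop_minorPoly k A B).pow (partGap l k)
  have he : ∑ k : Fin N, partGap l k • initialExp k = Finsupp.equivFunOnFinite.symm l := by
    ext i
    simp only [Finsupp.finsetSum_apply, Finsupp.smul_apply, initialExp_apply, smul_eq_mul, mul_ite,
      mul_one, mul_zero]
    exact sum_partGap hl i
  rw [he] at h
  simpa only [leadProdPoly, leadProd, mul_pow, Finset.prod_mul_distrib] using h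

theorem hasLexTop_vdmPoly :
    HasLexTop (vdmPoly N) (Finsupp.equivFunOnFinite.symm fun i : Fin N => N - 1 - (i : ℕ)) 1 := by
  have hmon : ∀ w : Equiv.Perm (Fin N),
      ∏ i, (X i : MvPolynomial (Fin N) ℂ) ^ (N - 1 - (w i : ℕ)) =
        monomial (Finsupp.equivFunOnFinite.symm fun i => N - 1 - (w i : ℕ)) 1 := by
    intro w
    rw [monomial_eq, C_1, one_mul, Finsupp.prod_fintype _ _ (by simp)]
    rfl
  have hsgn : ∀ w : Equiv.Perm (Fin N),
      (((Equiv.Perm.sign w : ℤˣ) : ℤ) : MvPolynomial (Fin N) ℂ) =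
        C ((Equiv.Perm.sign w : ℤˣ) : ℂ) := by
    simp
  have hcoeff : ∀ b, coeff b (vdmPoly N) = ∑ w : Equiv.Perm (Fin N), (Equiv.Perm.sign w : ℂ) *
      if Finsupp.equivFunOnFinite.symm (fun i => N - 1 - (w i : ℕ)) = b then 1 else 0 := by
    intro b
    rw [vdmPoly, ← det_transpose, det_apply', coeff_sum]
    simp only [transpose_apply, of_apply, hmon, hsgn, coeff_C_mul, coeff_monomial]
  have h1 : coeff (Finsupp.equivFunOnFinite.symm fun i : Fin N => N - 1 - (i : ℕ))
      (vdmPoly N) = 1 := by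
    rw [hcoeff, Finset.sum_eq_single 1]
    · simp
    · intro w _ hw
      rw [if_neg, mul_zero]
      intro he
      apply hw
      ext i
      have h2 : N - 1 - (w i : ℕ) = N - 1 - (i : ℕ) := DFunLike.congr_fun he i
      have h3 := (w i).isLt
      have h4 := i.isLt
      rw [Equiv.Perm.one_apply]
      omega
    · simp
  have h := HasLexTop.of_coeff (p := vdmPoly N)
    (a := Finsupp.equivFunOnFinite.symm fun i : Fin N => N - 1 - (i : ℕ)) ?_
  · rwa [h1] at h
  intro b hb
  rw [hcoeff] at hb
  obtain ⟨w, -, hw⟩ := Finset.exists_ne_zero_of_sum_ne_zero hb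
  have he := (ite_ne_right_iff.1 (right_ne_zero_of_mul hw)).1
  rw [← he]
  by_contra hlt
  obtain ⟨i, hj, hi⟩ := exists_lt_of_not_toLex_le hlt
  have hj' : ∀ j, j < i → w j = j := by
    intro j hji
    have h2 : N - 1 - (j : ℕ) = N - 1 - (w j : ℕ) := hj j hji
    have h3 := (w j).isLt
    have h4 := j.isLt
    ext
    omega
  have hi' : N - 1 - (i : ℕ) < N - 1 - (w i : ℕ) := hi
  have hwi : w i < i := by
    rw [Fin.lt_def]
    omega
  exact hwi.ne (w.injective (hj' _ hwi))

theorem coeff_vdmPoly_mul_leadProdPoly {l : Fin N → ℕ} (hl : Antitone l)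
    (A B : Matrix (Fin N) (Fin N) ℂ) :
    coeff (shiftedExp l) (vdmPoly N * leadProdPoly l A B) = leadProd l A * leadProd l B := by
  have h := (hasLexTop_vdmPoly.mul (hasLexTop_leadProdPoly hl A B)).2
  rw [one_mul] at h
  rw [← h]
  congr 1
  ext i
  exact Nat.add_comm _ _

theorem integral_schur_mul_leadProd (μ : Measure (SUN N)) [μ.IsHaarMeasure]
    (hN : 1 ≤ N) {l : Fin N → ℕ} (hl : Antitone l) :
    ∫ V, schur l (toMat V) * leadProd l (toMat V)ᴴ ∂μ = leadNorm l μ := by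
  rw [integral_schur_mul μ hN (leadProd_mem_polyFun l) (leadProd_homog hl)
    (q := fun V => leadProdPoly l (toMat V)ᴴ (toMat V)) fun V d => eval_leadProdPoly l _ _ d]
  simp only [coeff_vdmPoly_mul_leadProdPoly hl]
  simp only [leadNorm, mul_comm]

end LexTop

/-- `∫_{SU(N)} s_λ(UA) s_λ(U†B) dμ(U) = s_λ(AB)/s_λ(I_N)`. -/
theorem statement12 {N : ℕ} (hN : 1 ≤ N)
    (A B : Matrix (Fin N) (Fin N) ℂ)
    (l : Fin N → ℕ) (hl : Antitone l)
    (μ : Measure (SUN N)) [μ.IsHaarMeasure] [IsProbabilityMeasure μ] :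
    (∫ V : SUN N,
        schur l (((V : UN N) : Matrix (Fin N) (Fin N) ℂ) * A) *
          schur l (star ((V : UN N) : Matrix (Fin N) (Fin N) ℂ) * B) ∂μ) =
      schur l (A * B) / schur l (1 : Matrix (Fin N) (Fin N) ℂ) := by
  exact integral_mul_eq_div_of_pairing μ hN hl (schur_mem_polyFun l) (schur_homog l)
    (schur_mul_comm l) (schur_conjTranspose l) (integral_schur_mul_schur μ hN hl)
    (integral_schur_mul_leadProd μ hN hl) A B

end
end

section
/- Let f : M_N(ℂ) → ℂ be a polynomial function in the matrix entries and their complex conjugates. Then ∫_{SU(N)} f(U) dμ(U) = Σ_{q ∈ ℤ} ∫_{U(N)} f(U) (det U)^q d_*U, where all but finitely many terms of the sum on the right-hand side vanish. -/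
open scoped BigOperators Classical
open MeasureTheory Matrix

noncomputable section

instance (N : ℕ) : BorelSpace (UN N) := ⟨rfl⟩

instance inst_s13 (N : ℕ) : BorelSpace (SUN N) := ⟨rfl⟩

instance (N : ℕ) : CompactSpace (UN N) := by
  have hclosed : IsClosed (unitary (Matrix (Fin N) (Fin N) ℂ) : Set (Matrix (Fin N) (Fin N) ℂ)) :=
    isClosed_unitary
  refine isCompact_iff_compactSpace.mp (IsCompact.of_isClosed_subset
    (s := Set.univ.pi fun _ => Set.univ.pi fun _ => Metric.closedBall (0 : ℂ) 1)
    (isCompact_univ_pi fun _ => isCompact_univ_pi fun _ => isCompact_closedBall 0 1)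
    hclosed ?_)
  intro U hU i _ j _
  simpa using entry_norm_bound_of_unitary hU i j

instance inst_s13_2 (N : ℕ) : CompactSpace (SUN N) := by
  have hclosed : IsClosed (SUN N : Set (UN N)) :=
    isClosed_singleton.preimage (continuous_subtype_val.matrix_det)
  exact isCompact_iff_compactSpace.mp hclosed.isCompact

/-- A Haar probability measure on a compact group is right-invariant. -/
theorem isMulRightInvariant_of_isProbabilityMeasure {G : Type*} [Group G] [TopologicalSpace G]
    [IsTopologicalGroup G] [CompactSpace G] [MeasurableSpace G] [BorelSpace G]
    (μ : Measure G) [μ.IsHaarMeasure] [IsProbabilityMeasure μ] : μ.IsMulRightInvariant := by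
  refine ⟨fun g => ?_⟩
  have hprob : IsProbabilityMeasure (μ.map (· * g)) :=
    Measure.isProbabilityMeasure_map (measurable_mul_const g).aemeasurable
  have hhaar : (μ.map (· * g)).IsHaarMeasure :=
    Measure.isHaarMeasure_of_isCompact_nonempty_interior _ Set.univ isCompact_univ
      (by simp) (by simp) (by simp)
  exact Measure.isHaarMeasure_eq_of_isProbabilityMeasure _ _

theorem Continuous.integrable_of_compactSpace {G E : Type*} [TopologicalSpace G] [CompactSpace G]
    [MeasurableSpace G] [BorelSpace G] [NormedAddCommGroup E] {μ : Measure G}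
    [IsFiniteMeasureOnCompacts μ] {g : G → E} (hg : Continuous g) : Integrable g μ :=
  hg.integrable_of_hasCompactSupport (HasCompactSupport.of_compactSpace g)

/-- The scalar unitary matrix `z • 1` for `‖z‖ = 1`. -/
def scalarUN (N : ℕ) (z : ℂ) (hz : ‖z‖ = 1) : UN N :=
  ⟨z • 1, by
    rw [Matrix.mem_unitaryGroup_iff]
    simp [star_smul, smul_smul, Complex.conj_mul', hz]⟩

theorem coe_scalarUN_mul {N : ℕ} {z : ℂ} (hz : ‖z‖ = 1) (U : UN N) :
    ((scalarUN N z hz * U : UN N) : Matrix (Fin N) (Fin N) ℂ)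
      = z • (U : Matrix (Fin N) (Fin N) ℂ) := by
  simp [scalarUN]

theorem norm_det_eq_one {N : ℕ} (U : UN N) :
    ‖(U : Matrix (Fin N) (Fin N) ℂ).det‖ = 1 :=
  CStarRing.norm_of_mem_unitary (Matrix.det_of_mem_unitary U.2)

theorem continuous_det_zpow (N : ℕ) (q : ℤ) :
    Continuous fun U : UN N => (U : Matrix (Fin N) (Fin N) ℂ).det ^ q :=
  continuous_subtype_val.matrix_det.zpow₀ q fun U =>
    Or.inl (norm_ne_zero_iff.mp (by simp [norm_det_eq_one U]))

theorem exists_scalarUN_mul_SUN {N : ℕ} (hN : 1 ≤ N) (U : UN N) :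
    ∃ (z : ℂ) (hz : ‖z‖ = 1) (V : SUN N), U = scalarUN N z hz * (V : UN N) := by
  obtain ⟨z, hzN⟩ := IsAlgClosed.exists_pow_nat_eq
    (U : Matrix (Fin N) (Fin N) ℂ).det (n := N) (by omega)
  have hz : ‖z‖ = 1 := by
    rw [← pow_eq_one_iff_of_nonneg (norm_nonneg z) (n := N) (by omega), ← norm_pow, hzN,
      norm_det_eq_one]
  have hz0 : z ≠ 0 := norm_ne_zero_iff.mp (by simp [hz])
  have hz' : ‖z⁻¹‖ = 1 := by simp [hz]
  refine ⟨z, hz, ⟨scalarUN N z⁻¹ hz' * U, ?_⟩, ?_⟩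
  · change ((scalarUN N z⁻¹ hz' * U : UN N) : Matrix (Fin N) (Fin N) ℂ).det = 1
    rw [coe_scalarUN_mul, Matrix.det_smul, ← hzN, Fintype.card_fin, ← mul_pow,
      inv_mul_cancel₀ hz0, one_pow]
  · apply Subtype.ext
    rw [coe_scalarUN_mul]
    change _ = z • ((scalarUN N z⁻¹ hz' * U : UN N) : Matrix (Fin N) (Fin N) ℂ)
    rw [coe_scalarUN_mul, smul_smul, mul_inv_cancel₀ hz0, one_smul]

theorem exists_norm_one_zpow_ne_one {m : ℤ} (hm : m ≠ 0) : ∃ z : ℂ, ‖z‖ = 1 ∧ z ^ m ≠ 1 := by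
  refine ⟨Complex.exp ((Real.pi / m : ℝ) * Complex.I), Complex.norm_exp_ofReal_mul_I _, ?_⟩
  have hm' : (m : ℂ) ≠ 0 := Int.cast_ne_zero.mpr hm
  rw [← Complex.exp_int_mul]
  have harg : (m : ℂ) * ((Real.pi / m : ℝ) * Complex.I) = Real.pi * Complex.I := by
    push_cast
    field_simp
  rw [harg, Complex.exp_pi_mul_I]
  norm_num

section Integrals

variable {N : ℕ} (μU : Measure (UN N)) [μU.IsHaarMeasure]
  (μSU : Measure (SUN N)) [μSU.IsHaarMeasure]

variable {g : Matrix (Fin N) (Fin N) ℂ → ℂ} {k : ℤ}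

theorem integral_UN_mul_det_zpow_eq_zero
    (hw : ∀ z : ℂ, ‖z‖ = 1 → ∀ X, g (z • X) = z ^ k * g X) {q : ℤ} (hq : k + N * q ≠ 0) :
    ∫ U : UN N, g U * (U : Matrix (Fin N) (Fin N) ℂ).det ^ q ∂μU = 0 := by
  obtain ⟨z, hz, hzm⟩ := exists_norm_one_zpow_ne_one hq
  have hz0 : z ≠ 0 := norm_ne_zero_iff.mp (by simp [hz])
  have h := integral_mul_left_eq_self (μ := μU)
    (fun U : UN N => g U * (U : Matrix (Fin N) (Fin N) ℂ).det ^ q) (scalarUN N z hz)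
  have hscale (U : UN N) : z ^ k * g U * (z ^ N * (U : Matrix (Fin N) (Fin N) ℂ).det) ^ q
      = z ^ (k + N * q) * (g U * (U : Matrix (Fin N) (Fin N) ℂ).det ^ q) := by
    rw [mul_zpow, zpow_add₀ hz0, _root_.zpow_mul, zpow_natCast]
    ring
  simp only [coe_scalarUN_mul, hw z hz, Matrix.det_smul, Fintype.card_fin, hscale] at h
  rw [integral_const_mul] at h
  by_contra h0
  exact hzm (mul_right_cancel₀ h0 (by rw [h, one_mul]))

theorem integral_SUN_eq_zero (hN : 1 ≤ N)
    (hw : ∀ z : ℂ, ‖z‖ = 1 → ∀ X, g (z • X) = z ^ k * g X) (hk : ¬ (N : ℤ) ∣ k) :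
    ∫ V : SUN N, g ((V : UN N) : Matrix (Fin N) (Fin N) ℂ) ∂μSU = 0 := by
  have hprim := Complex.isPrimitiveRoot_exp N (by omega)
  set z := Complex.exp (2 * Real.pi * Complex.I / N)
  have hz : ‖z‖ = 1 := hprim.norm'_eq_one (by omega)
  let W : SUN N := ⟨scalarUN N z hz, by
    change (z • (1 : Matrix (Fin N) (Fin N) ℂ)).det = 1
    simp [hprim.pow_eq_one]⟩
  have h := integral_mul_left_eq_self (μ := μSU)
    (fun V : SUN N => g ((V : UN N) : Matrix (Fin N) (Fin N) ℂ)) W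
  have hmul (V : SUN N) : (((W * V : SUN N) : UN N) : Matrix (Fin N) (Fin N) ℂ)
      = z • ((V : UN N) : Matrix (Fin N) (Fin N) ℂ) := coe_scalarUN_mul hz V.1
  simp only [hmul, hw z hz] at h
  rw [integral_const_mul] at h
  by_contra h0
  exact hk ((hprim.zpow_eq_one_iff_dvd k).mp (mul_right_cancel₀ h0 (by rw [h, one_mul])))

variable [IsProbabilityMeasure μU] [IsProbabilityMeasure μSU]

/-- A continuous function on `U(N)` invariant under scalars has the same average over `U(N)` and
over `SU(N)`. -/
theorem integral_SUN_eq_integral_UN_of_scalar_invariant (hN : 1 ≤ N) {h : UN N → ℂ}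
    (hh : Continuous h)
    (hinv : ∀ (z : ℂ) (hz : ‖z‖ = 1) (U : UN N), h (scalarUN N z hz * U) = h U) :
    ∫ V : SUN N, h V ∂μSU = ∫ U, h U ∂μU := by
  have := isMulRightInvariant_of_isProbabilityMeasure μU
  have hfibre (U : UN N) : ∫ V : SUN N, h (U * V) ∂μSU = ∫ V : SUN N, h V ∂μSU := by
    obtain ⟨z, hz, W, rfl⟩ := exists_scalarUN_mul_SUN hN U
    simp only [mul_assoc, hinv]
    exact integral_mul_left_eq_self (μ := μSU) (fun V : SUN N => h V) W
  calc ∫ V : SUN N, h V ∂μSU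
      = ∫ U, ∫ V : SUN N, h (U * V) ∂μSU ∂μU := by simp [hfibre]
    _ = ∫ V : SUN N, ∫ U, h (U * V) ∂μU ∂μSU :=
        integral_integral_swap_of_hasCompactSupport
          (f := fun (U : UN N) (V : SUN N) => h (U * V))
          (by unfold Function.uncurry; fun_prop) (HasCompactSupport.of_compactSpace _)
    _ = ∫ U, h U ∂μU := by simp [integral_mul_right_eq_self (μ := μU) h]

theorem integral_SUN_eq_integral_UN_mul_det_zpow (hN : 1 ≤ N)
    (hg : Continuous g) (hw : ∀ z : ℂ, ‖z‖ = 1 → ∀ X, g (z • X) = z ^ k * g X)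
    {q : ℤ} (hq : k + N * q = 0) :
    ∫ V : SUN N, g ((V : UN N) : Matrix (Fin N) (Fin N) ℂ) ∂μSU
      = ∫ U : UN N, g U * (U : Matrix (Fin N) (Fin N) ℂ).det ^ q ∂μU := by
  rw [← integral_SUN_eq_integral_UN_of_scalar_invariant μU μSU hN
    (h := fun U => g U * (U : Matrix (Fin N) (Fin N) ℂ).det ^ q)
    ((hg.comp continuous_subtype_val).mul (continuous_det_zpow N q))]
  · refine integral_congr_ae (.of_forall fun V => ?_)
    have hV : ((V : UN N) : Matrix (Fin N) (Fin N) ℂ).det = 1 := V.2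
    simp [hV]
  · intro z hz U
    have hz0 : z ≠ 0 := norm_ne_zero_iff.mp (by simp [hz])
    have hzq : z ^ k * (z ^ N) ^ q = 1 := by
      rw [← zpow_natCast, ← _root_.zpow_mul, ← zpow_add₀ hz0, hq, zpow_zero]
    simp only [coe_scalarUN_mul, hw z hz, Matrix.det_smul, Fintype.card_fin,
      mul_zpow]
    linear_combination (g U * (U : Matrix (Fin N) (Fin N) ℂ).det ^ q) * hzq

/-- The claim for functions of a fixed weight under multiplication by unit scalars. -/
theorem finite_and_hasSum_of_weight (hN : 1 ≤ N)
    (hg : Continuous g) (hw : ∀ z : ℂ, ‖z‖ = 1 → ∀ X, g (z • X) = z ^ k * g X) :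
    {q : ℤ | ∫ U : UN N, g U * (U : Matrix (Fin N) (Fin N) ℂ).det ^ q ∂μU ≠ 0}.Finite ∧
    HasSum (fun q : ℤ => ∫ U : UN N, g U * (U : Matrix (Fin N) (Fin N) ℂ).det ^ q ∂μU)
      (∫ V : SUN N, g ((V : UN N) : Matrix (Fin N) (Fin N) ℂ) ∂μSU) := by
  by_cases hk : (N : ℤ) ∣ k
  · obtain ⟨l, rfl⟩ := hk
    have hzero (q : ℤ) (hq : q ≠ -l) :
        ∫ U : UN N, g U * (U : Matrix (Fin N) (Fin N) ℂ).det ^ q ∂μU = 0 := by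
      refine integral_UN_mul_det_zpow_eq_zero μU hw fun h => hq ?_
      have hN' : (N : ℤ) ≠ 0 := by omega
      have : (N : ℤ) * (l + q) = 0 := by linarith
      have := (mul_eq_zero.mp this).resolve_left hN'
      omega
    refine ⟨(Set.finite_singleton (-l)).subset fun q hq => by_contra fun h => hq (hzero q h), ?_⟩
    rw [integral_SUN_eq_integral_UN_mul_det_zpow μU μSU hN hg hw (q := -l) (by ring)]
    exact hasSum_single (-l) hzero
  · have hzero (q : ℤ) :
        ∫ U : UN N, g U * (U : Matrix (Fin N) (Fin N) ℂ).det ^ q ∂μU = 0 :=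
      integral_UN_mul_det_zpow_eq_zero μU hw fun h => hk ⟨-q, by linarith⟩
    simp only [hzero, integral_SUN_eq_zero μSU hN hw hk, ne_eq, not_true_eq_false, Set.ofPred_false]
    exact ⟨Set.finite_empty, hasSum_zero⟩

end Integrals

/-- The value at `X` of a polynomial in the entries of a matrix and their conjugates. -/
def evalEntries {N : ℕ} (P : MvPolynomial ((Fin N × Fin N) ⊕ (Fin N × Fin N)) ℂ)
    (X : Matrix (Fin N) (Fin N) ℂ) : ℂ :=
  MvPolynomial.eval (Sum.elim (fun p => X p.1 p.2) (fun p => starRingEnd ℂ (X p.1 p.2))) P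

theorem continuous_evalEntries {N : ℕ}
    (P : MvPolynomial ((Fin N × Fin N) ⊕ (Fin N × Fin N)) ℂ) : Continuous (evalEntries P) := by
  refine (MvPolynomial.continuous_eval P).comp (continuous_pi ?_)
  rintro (p | p)
  · exact continuous_id.matrix_elem p.1 p.2
  · exact Complex.continuous_conj.comp (continuous_id.matrix_elem p.1 p.2)

theorem exists_weight_evalEntries_monomial {N : ℕ}
    (d : (Fin N × Fin N) ⊕ (Fin N × Fin N) →₀ ℕ) (a : ℂ) :
    ∃ k : ℤ, ∀ z : ℂ, ‖z‖ = 1 → ∀ X,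
      evalEntries (MvPolynomial.monomial d a) (z • X)
        = z ^ k * evalEntries (MvPolynomial.monomial d a) X := by
  let w : (Fin N × Fin N) ⊕ (Fin N × Fin N) → ℤ := Sum.elim 1 (-1)
  refine ⟨∑ i ∈ d.support, w i * d i, fun z hz X => ?_⟩
  have hz0 : z ≠ 0 := norm_ne_zero_iff.mp (by simp [hz])
  have hvar (i : (Fin N × Fin N) ⊕ (Fin N × Fin N)) :
      Sum.elim (fun p => (z • X) p.1 p.2) (fun p => starRingEnd ℂ ((z • X) p.1 p.2)) i
        = z ^ w i * Sum.elim (fun p => X p.1 p.2) (fun p => starRingEnd ℂ (X p.1 p.2)) i := by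
    rcases i with p | p
    · simp [w]
    · simp [w, Complex.inv_eq_conj hz]
  have hprod : ∏ i ∈ d.support, (z ^ w i) ^ d i = z ^ ∑ i ∈ d.support, w i * (d i : ℤ) := by
    induction d.support using Finset.induction_on with
    | empty => simp
    | insert i s hi ih =>
      rw [Finset.prod_insert hi, Finset.sum_insert hi, zpow_add₀ hz0, ih, _root_.zpow_mul,
        zpow_natCast]
  simp only [evalEntries, MvPolynomial.eval_monomial, Finsupp.prod, hvar, mul_pow,
    Finset.prod_mul_distrib, hprod]
  ring

theorem finite_and_hasSum_evalEntries {N : ℕ} (hN : 1 ≤ N)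
    (μU : Measure (UN N)) [μU.IsHaarMeasure] [IsProbabilityMeasure μU]
    (μSU : Measure (SUN N)) [μSU.IsHaarMeasure] [IsProbabilityMeasure μSU]
    (P : MvPolynomial ((Fin N × Fin N) ⊕ (Fin N × Fin N)) ℂ) :
    {q : ℤ | ∫ U : UN N, evalEntries P U * (U : Matrix (Fin N) (Fin N) ℂ).det ^ q ∂μU ≠ 0}.Finite ∧
    HasSum (fun q : ℤ => ∫ U : UN N, evalEntries P U * (U : Matrix (Fin N) (Fin N) ℂ).det ^ q ∂μU)
      (∫ V : SUN N, evalEntries P ((V : UN N) : Matrix (Fin N) (Fin N) ℂ) ∂μSU) := by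
  induction P using MvPolynomial.induction_on' with
  | monomial d a =>
    obtain ⟨k, hw⟩ := exists_weight_evalEntries_monomial d a
    exact finite_and_hasSum_of_weight μU μSU hN (continuous_evalEntries _) hw
  | add P Q hP hQ =>
    have hadd (X : Matrix (Fin N) (Fin N) ℂ) :
        evalEntries (P + Q) X = evalEntries P X + evalEntries Q X := map_add _ _ _
    have hcontU (R : MvPolynomial ((Fin N × Fin N) ⊕ (Fin N × Fin N)) ℂ) :
        Continuous fun U : UN N => evalEntries R (U : Matrix (Fin N) (Fin N) ℂ) :=
      (continuous_evalEntries R).comp continuous_subtype_val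
    have hU (R : MvPolynomial ((Fin N × Fin N) ⊕ (Fin N × Fin N)) ℂ) (q : ℤ) :
        Integrable (fun U : UN N => evalEntries R U * (U : Matrix (Fin N) (Fin N) ℂ).det ^ q) μU :=
      ((hcontU R).mul (continuous_det_zpow N q)).integrable_of_compactSpace
    have hSU (R : MvPolynomial ((Fin N × Fin N) ⊕ (Fin N × Fin N)) ℂ) :
        Integrable (fun V : SUN N => evalEntries R ((V : UN N) : Matrix (Fin N) (Fin N) ℂ)) μSU :=
      ((hcontU R).comp continuous_subtype_val).integrable_of_compactSpace
    simp only [hadd, add_mul, integral_add (hU P _) (hU Q _), integral_add (hSU P) (hSU Q)]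
    refine ⟨(hP.1.union hQ.1).subset fun q hq => ?_, hP.2.add hQ.2⟩
    by_contra h
    simp only [Set.mem_union, Set.mem_ofPred_eq, not_or, not_not] at h
    exact hq (by rw [h.1, h.2, add_zero])

/-- For a polynomial function `f` of the matrix entries and their
complex conjugates, `∫_{SU(N)} f(U) dμ(U) = Σ_{q ∈ ℤ} ∫_{U(N)} f(U) (det U)^q d_*U`,
with all but finitely many terms of the sum vanishing. -/
theorem statement13 {N : ℕ} (hN : 1 ≤ N)
    (f : Matrix (Fin N) (Fin N) ℂ → ℂ)
    (hf : ∃ P : MvPolynomial ((Fin N × Fin N) ⊕ (Fin N × Fin N)) ℂ,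
      ∀ X : Matrix (Fin N) (Fin N) ℂ,
        f X = MvPolynomial.eval
          (Sum.elim (fun p => X p.1 p.2) (fun p => starRingEnd ℂ (X p.1 p.2))) P)
    (μU : Measure (UN N)) [μU.IsHaarMeasure] [IsProbabilityMeasure μU]
    (μSU : Measure (SUN N)) [μSU.IsHaarMeasure] [IsProbabilityMeasure μSU] :
    {q : ℤ | (∫ U : UN N, f (U : Matrix (Fin N) (Fin N) ℂ) * ((U : Matrix (Fin N) (Fin N) ℂ).det) ^ q ∂μU) ≠ 0}.Finite ∧
    (∫ V : SUN N, f ((V : UN N) : Matrix (Fin N) (Fin N) ℂ) ∂μSU) =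
      ∑' q : ℤ, ∫ U : UN N, f (U : Matrix (Fin N) (Fin N) ℂ) * ((U : Matrix (Fin N) (Fin N) ℂ).det) ^ q ∂μU := by
  obtain ⟨P, hP⟩ := hf
  obtain rfl : f = evalEntries P := funext hP
  have h := finite_and_hasSum_evalEntries hN μU μSU P
  exact ⟨h.1, h.2.tsum_eq.symm⟩

end
end
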